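/- arXiv:1703.00438 — 2 statements merged into one kernel-verified Lean document; each statement's English description precedes it below -/
import Mathlib

section
/- Let 1 ≤ b ≤ n−1 and suppose g_1,…,g_n ∈ S is a regular sequence of homogeneous forms of degree d such that g_{b+1},…,g_n lie in the ideal (x_{b+1},…,x_n) and (x_{b+1},…,x_n)^{(n−b)(d−1)+1} ⊆ (g_1,…,g_n). Then (x_{b+1},…,x_n)^{(n−b)(d−1)+1} ⊆ (g_{b+1},…,g_n). -/
open MvPolynomial

section RegularOn

variable {R : Type*} [CommRing R]

/-- The list `l` is a weakly regular sequence on `R ⧸ I`, phrased through ideal membership. -/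
def IsRegOn : Ideal R → List R → Prop
  | _, [] => True
  | I, a :: l => (∀ h, a * h ∈ I → h ∈ I) ∧ IsRegOn (I ⊔ Ideal.span {a}) l

theorem sup_span_sup_ofList (I : Ideal R) (a : R) (l : List R) :
    I ⊔ Ideal.span {a} ⊔ Ideal.ofList l = I ⊔ Ideal.ofList (a :: l) := by
  rw [Ideal.ofList_cons, sup_assoc]

theorem isRegOn_append (I : Ideal R) (l₁ l₂ : List R) :
    IsRegOn I (l₁ ++ l₂) ↔ IsRegOn I l₁ ∧ IsRegOn (I ⊔ Ideal.ofList l₁) l₂ := by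
  induction l₁ generalizing I with
  | nil => simp [IsRegOn]
  | cons a l ih => simp [IsRegOn, ih, and_assoc, sup_assoc]

theorem isRegOn_of_isWeaklyRegular {l : List R}
    (h : RingTheory.Sequence.IsWeaklyRegular R l) : IsRegOn ⊥ l := by
  rw [RingTheory.Sequence.isWeaklyRegular_iff] at h
  induction l using List.reverseRecOn with
  | nil => trivial
  | append_singleton l a ih =>
    rw [isRegOn_append]
    refine ⟨ih fun i hi => ?_, ?_, trivial⟩
    · have := h i (by simp; omega)
      rw [List.take_append_of_le_length hi.le, List.getElem_append_left hi] at this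
      exact this
    · have := h l.length (by simp)
      intro x hx
      rw [List.take_left, List.getElem_append_right le_rfl] at this
      simp only [Nat.sub_self, List.getElem_cons_zero, isSMulRegular_iff_right_eq_zero_of_smul,
        smul_eq_mul] at this
      have h0 := this (Submodule.Quotient.mk x)
      rw [← Submodule.Quotient.mk_smul, Submodule.Quotient.mk_eq_zero,
        Submodule.Quotient.mk_eq_zero] at h0
      simpa using h0 (by simpa using hx)

end RegularOn

section Ext

open CategoryTheory CategoryTheory.Abelian

universe u

variable {R : Type u} [CommRing R]

/-- The short complex `R ⧸ I → R ⧸ I → R ⧸ (I + (a))` whose first map is multiplication by `a`. -/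
noncomputable def quotMulShortComplex (I : Ideal R) (a : R) : ShortComplex (ModuleCat.{u} R) :=
  ModuleCat.shortComplexOfCompEqZero (LinearMap.lsmul R (R ⧸ I) a)
    (Submodule.factor (le_sup_left : I ≤ I ⊔ Ideal.span {a})) (by
      ext
      simp only [LinearMap.comp_apply, LinearMap.lsmul_apply, map_smul, LinearMap.zero_apply]
      change a • (Ideal.Quotient.mk _ 1) = 0
      rw [← Ideal.Quotient.mk_eq_mk, ← Submodule.Quotient.mk_smul, Submodule.Quotient.mk_eq_zero]
      simpa using Ideal.mem_sup_right (Ideal.mem_span_singleton_self a))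

theorem quotMulShortComplex_shortExact {I : Ideal R} {a : R} (ha : ∀ h, a * h ∈ I → h ∈ I) :
    (quotMulShortComplex I a).ShortExact where
  exact := by
    refine ModuleCat.shortComplex_exact _ ?_
    intro x
    obtain ⟨x, rfl⟩ := Submodule.Quotient.mk_surjective _ x
    change Submodule.Quotient.mk x = 0 ↔ _
    rw [Submodule.Quotient.mk_eq_zero]
    constructor
    · intro hx
      obtain ⟨i, hi, j, hj, rfl⟩ := Submodule.mem_sup.1 hx
      obtain ⟨y, rfl⟩ := Ideal.mem_span_singleton'.1 hj
      refine ⟨Submodule.Quotient.mk y, ?_⟩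
      change a • (Submodule.Quotient.mk y : R ⧸ I) = _
      rw [← Submodule.Quotient.mk_smul, Submodule.Quotient.eq]
      simpa [mul_comm] using hi
    · rintro ⟨y, hy⟩
      obtain ⟨y, rfl⟩ := Submodule.Quotient.mk_surjective _ y
      change a • (Submodule.Quotient.mk y : R ⧸ I) = _ at hy
      rw [← Submodule.Quotient.mk_smul, Submodule.Quotient.eq] at hy
      have : x = a * y - (a * y - x) := by ring
      rw [this]
      exact sub_mem
        (Ideal.mem_sup_right (Ideal.mul_mem_right _ _ (Ideal.mem_span_singleton_self a)))
        (Ideal.mem_sup_left hy)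
  mono_f := by
    rw [ModuleCat.mono_iff_injective]
    change Function.Injective (fun x : R ⧸ I => a • x)
    intro x y hxy
    obtain ⟨x, rfl⟩ := Submodule.Quotient.mk_surjective _ x
    obtain ⟨y, rfl⟩ := Submodule.Quotient.mk_surjective _ y
    simp only [← Submodule.Quotient.mk_smul, Submodule.Quotient.eq] at hxy ⊢
    exact ha _ (by simpa [mul_sub] using hxy)
  epi_g := by
    rw [ModuleCat.epi_iff_surjective]
    exact Submodule.factor_surjective (le_sup_left : I ≤ I ⊔ Ideal.span {a})

theorem comp_quotMulShortComplex_f_eq_zero (N : ModuleCat.{u} R) {I : Ideal R} {a : R}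
    (ha : a ∈ Module.annihilator R N) {n : ℕ} (x : Ext N (ModuleCat.of R (R ⧸ I)) n) :
    x.comp (Ext.mk₀ (quotMulShortComplex I a).f) (add_zero n) = 0 := by
  have h2 : a • 𝟙 N = 0 := by
    simp [← ModuleCat.lsmul_eq_smul_id, Module.mem_annihilator_iff_lsmul_eq_zero.mp ha]
  have h3 : a • x = (Ext.mk₀ (a • 𝟙 N)).comp x (zero_add n) := by simp [Ext.mk₀_smul]
  have h4 : x.comp (Ext.mk₀ (a • 𝟙 (ModuleCat.of R (R ⧸ I)))) (add_zero n) = 0 := by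
    rw [← Ext.smul_eq_comp_mk₀, h3, h2]
    simp
  exact h4

theorem ext_subsingleton_and_nonempty_linearEquiv (N : ModuleCat.{u} R) (l : List R)
    (hl : ∀ a ∈ l, a ∈ Module.annihilator R N) (I : Ideal R) (hreg : IsRegOn I l) :
    (∀ i < l.length, Subsingleton (Ext N (ModuleCat.of R (R ⧸ I)) i)) ∧
      Nonempty (Ext N (ModuleCat.of R (R ⧸ I)) l.length ≃ₗ[R]
        (N →ₗ[R] (R ⧸ (I ⊔ Ideal.ofList l)))) := by
  induction l generalizing I with
  | nil =>
    let e₁ : Ext N (ModuleCat.of R (R ⧸ I)) 0 ≃ₗ[R] (N ⟶ ModuleCat.of R (R ⧸ I)) :=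
      Ext.linearEquiv₀
    let e₂ : (N ⟶ ModuleCat.of R (R ⧸ I)) ≃ₗ[R] (N →ₗ[R] (R ⧸ I)) :=
      ModuleCat.homLinearEquiv
    let e₃ : (R ⧸ I) ≃ₗ[R] (R ⧸ (I ⊔ Ideal.ofList [])) :=
      Submodule.quotEquivOfEq _ _ (by simp)
    exact ⟨by simp, ⟨e₁.trans (e₂.trans (LinearEquiv.congrRight e₃))⟩⟩
  | cons a l ih =>
    obtain ⟨ih1, ⟨e⟩⟩ := ih (fun b hb => hl b (List.mem_cons_of_mem _ hb)) _ hreg.2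
    have hS := quotMulShortComplex_shortExact hreg.1
    have ha := hl a List.mem_cons_self
    have hsurj : ∀ (i : ℕ) (x : Ext N (ModuleCat.of R (R ⧸ I)) (i + 1)),
        ∃ y : Ext N (ModuleCat.of R (R ⧸ (I ⊔ Ideal.span {a}))) i,
          y.comp hS.extClass rfl = x := fun i x =>
      Ext.covariant_sequence_exact₁ N hS x (comp_quotMulShortComplex_f_eq_zero N ha x) rfl
    have hvan : ∀ i < l.length + 1, Subsingleton (Ext N (ModuleCat.of R (R ⧸ I)) i) := by
      intro i hi
      cases i with
      | zero =>
        refine ⟨fun x y => sub_eq_zero.1 ?_⟩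
        have := hS.mono_f
        exact (Ext.postcomp_mk₀_injective_of_mono N (quotMulShortComplex I a).f)
          (Eq.trans (comp_quotMulShortComplex_f_eq_zero N ha (x - y))
            (map_zero ((Ext.mk₀ (quotMulShortComplex I a).f).postcomp N (add_zero 0))).symm)
      | succ i =>
        have := ih1 i (by omega)
        refine ⟨fun x y => ?_⟩
        obtain ⟨x, rfl⟩ := hsurj i x
        obtain ⟨y, rfl⟩ := hsurj i y
        rw [Subsingleton.elim x y]
    refine ⟨hvan, ⟨?_⟩⟩
    let δ : Ext N (ModuleCat.of R (R ⧸ (I ⊔ Ideal.span {a}))) l.length →ₗ[R]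
        Ext N (ModuleCat.of R (R ⧸ I)) (l.length + 1) :=
      Ext.postcompOfLinear hS.extClass R N rfl
    have hδ : Function.Bijective δ := by
      refine ⟨?_, hsurj _⟩
      rw [← LinearMap.ker_eq_bot, LinearMap.ker_eq_bot']
      intro x hx
      obtain ⟨y, rfl⟩ := Ext.covariant_sequence_exact₃ N hS x rfl hx
      have := hvan l.length (by omega)
      have hy : y = 0 := Subsingleton.elim (α := Ext N (ModuleCat.of R (R ⧸ I)) l.length) _ _
      rw [hy]
      exact Ext.zero_comp N _ (Ext.mk₀ (quotMulShortComplex I a).g) l.length (add_zero _)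
    exact (LinearEquiv.ofBijective δ hδ).symm.trans
      (e.trans (LinearEquiv.congrRight
        (Submodule.quotEquivOfEq _ _ (sup_span_sup_ofList I a l))))

/-- If `a` and `c` are weakly regular sequences of the same length on `R ⧸ I` with all `a` in `(c)`,
then `(I + (a)) : (c)` is generated over `I + (a)` by one element `u`, and
`(I + (a)) : u = I + (c)`. -/
theorem exists_colon_generator (I : Ideal R) {a c : List R} (hlen : a.length = c.length)
    (hac : ∀ x ∈ a, x ∈ Ideal.ofList c) (ha : IsRegOn I a) (hc : IsRegOn I c) :
    ∃ u : R, (∀ h, (∀ p ∈ Ideal.ofList c, h * p ∈ I ⊔ Ideal.ofList a) ↔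
        ∃ r, h - r * u ∈ I ⊔ Ideal.ofList a) ∧
      ∀ h, h * u ∈ I ⊔ Ideal.ofList a ↔ h ∈ I ⊔ Ideal.ofList c := by
  set P := Ideal.ofList c with hP
  set A := I ⊔ Ideal.ofList a with hA
  let N : ModuleCat.{u} R := ModuleCat.of R (R ⧸ P)
  have hann : Module.annihilator R N = P := Ideal.annihilator_quotient
  obtain ⟨e₁⟩ := (ext_subsingleton_and_nonempty_linearEquiv N a (by rwa [hann]) I ha).2
  obtain ⟨e₂⟩ := (ext_subsingleton_and_nonempty_linearEquiv N c
    (by rw [hann]; exact fun x hx => Ideal.subset_span hx) I hc).2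
  rw [← hlen] at e₂
  let e : ((R ⧸ P) →ₗ[R] (R ⧸ (I ⊔ P))) ≃ₗ[R] ((R ⧸ P) →ₗ[R] (R ⧸ A)) := e₂.symm.trans e₁
  let φ : (R ⧸ P) →ₗ[R] (R ⧸ (I ⊔ P)) := Submodule.factor le_sup_right
  have hφ : ∀ f : (R ⧸ P) →ₗ[R] (R ⧸ (I ⊔ P)), ∃ r : R, f = r • φ := by
    intro f
    obtain ⟨r, hr⟩ := Submodule.Quotient.mk_surjective _ (f (Submodule.Quotient.mk 1))
    refine ⟨r, ?_⟩
    ext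
    change f (Submodule.Quotient.mk 1) = r • (Submodule.Quotient.mk 1 : R ⧸ (I ⊔ P))
    rw [← hr, ← Submodule.Quotient.mk_smul, smul_eq_mul, mul_one]
  have hφ0 : ∀ r : R, r • φ = 0 ↔ r ∈ I ⊔ P := by
    intro r
    have : r • φ = 0 ↔ (r • φ) (Submodule.Quotient.mk 1) = 0 := by
      refine ⟨fun h => by rw [h]; rfl, fun h => ?_⟩
      ext
      exact h
    rw [this]
    change r • (Submodule.Quotient.mk 1 : R ⧸ (I ⊔ P)) = 0 ↔ _
    rw [← Submodule.Quotient.mk_smul, smul_eq_mul, mul_one, Submodule.Quotient.mk_eq_zero]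
  obtain ⟨u, hu⟩ := Submodule.Quotient.mk_surjective _ (e φ (Submodule.Quotient.mk 1))
  have hmk : ∀ r : R, (r • e φ) (Submodule.Quotient.mk 1) = Submodule.Quotient.mk (r * u) := by
    intro r
    rw [LinearMap.smul_apply, ← hu, ← Submodule.Quotient.mk_smul, smul_eq_mul]
  have hext : ∀ f g : (R ⧸ P) →ₗ[R] (R ⧸ A),
      f (Submodule.Quotient.mk 1) = g (Submodule.Quotient.mk 1) → f = g := by
    intro f g h
    ext
    exact h
  have hzero : ∀ h, h * u ∈ A ↔ h ∈ I ⊔ P := by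
    intro h
    rw [← hφ0, ← (Submodule.Quotient.mk_eq_zero A), ← hmk, ← e.map_eq_zero_iff, map_smul]
    exact ⟨fun h' => hext _ _ h', fun h' => by rw [h']; rfl⟩
  refine ⟨u, fun h => ⟨fun hh => ?_, ?_⟩, hzero⟩
  · let ψ : (R ⧸ P) →ₗ[R] (R ⧸ A) := Submodule.liftQ P (LinearMap.toSpanSingleton R (R ⧸ A)
      (Submodule.Quotient.mk h)) (by
        intro p hp
        rw [LinearMap.mem_ker, LinearMap.toSpanSingleton_apply, ← Submodule.Quotient.mk_smul,
          Submodule.Quotient.mk_eq_zero, smul_eq_mul, mul_comm]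
        exact hh p hp)
    obtain ⟨r, hr⟩ := hφ (e.symm ψ)
    refine ⟨r, ?_⟩
    rw [← Submodule.Quotient.eq, ← hmk, ← map_smul, ← hr, e.apply_symm_apply]
    change _ = (1 : R) • (Submodule.Quotient.mk h : R ⧸ A)
    rw [one_smul]
  · rintro ⟨r, hr⟩ p hp
    have : h * p = (h - r * u) * p + r * (p * u) := by ring
    rw [this]
    exact add_mem (Ideal.mul_mem_right _ _ hr)
      (Ideal.mul_mem_left _ _ ((hzero p).2 (Ideal.mem_sup_right hp)))

end Ext

section Homogeneous

variable {σ k : Type*} [CommRing k]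

theorem homogeneousComponent_add_mul {a : MvPolynomial σ k} {p : ℕ} (ha : a.IsHomogeneous p)
    (h : MvPolynomial σ k) (e : ℕ) :
    homogeneousComponent (e + p) (a * h) = a * homogeneousComponent e h := by
  conv_lhs => rw [← sum_homogeneousComponent h, Finset.mul_sum, map_sum]
  have (i : ℕ) : homogeneousComponent (e + p) (a * homogeneousComponent i h) =
      if i = e then a * homogeneousComponent e h else 0 := by
    rw [homogeneousComponent_of_mem (ha.mul (homogeneousComponent_isHomogeneous i h))]
    split_ifs with h1 h2 h2
    · rw [h2]
    · omega
    · omega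
    · rfl
  simp only [this, Finset.sum_ite_eq', Finset.mem_range]
  split_ifs with h1
  · rfl
  · rw [homogeneousComponent_eq_zero _ _ (by omega), mul_zero]

theorem homogeneousComponent_mul_of_lt {a : MvPolynomial σ k} {p e : ℕ} (ha : a.IsHomogeneous p)
    (h : MvPolynomial σ k) (hep : e < p) : homogeneousComponent e (a * h) = 0 := by
  conv_lhs => rw [← sum_homogeneousComponent h, Finset.mul_sum, map_sum]
  refine Finset.sum_eq_zero fun i _ => ?_
  rw [homogeneousComponent_of_mem (ha.mul (homogeneousComponent_isHomogeneous i h)),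
    if_neg (by omega)]

/-- The ideal `I` contains the homogeneous components of its elements. -/
def IsHomogeneousIdeal (I : Ideal (MvPolynomial σ k)) : Prop :=
  ∀ f ∈ I, ∀ e, homogeneousComponent e f ∈ I

theorem isHomogeneousIdeal_bot : IsHomogeneousIdeal (⊥ : Ideal (MvPolynomial σ k)) := by
  intro f hf e
  rw [Ideal.mem_bot] at hf ⊢
  rw [hf, map_zero]

theorem IsHomogeneousIdeal.sup {I J : Ideal (MvPolynomial σ k)} (hI : IsHomogeneousIdeal I)
    (hJ : IsHomogeneousIdeal J) : IsHomogeneousIdeal (I ⊔ J) := by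
  intro f hf e
  obtain ⟨i, hi, j, hj, rfl⟩ := Submodule.mem_sup.1 hf
  rw [map_add]
  exact add_mem (Ideal.mem_sup_left (hI i hi e)) (Ideal.mem_sup_right (hJ j hj e))

theorem isHomogeneousIdeal_span {s : Set (MvPolynomial σ k)}
    (hs : ∀ a ∈ s, ∃ p, a.IsHomogeneous p) : IsHomogeneousIdeal (Ideal.span s) := by
  intro f hf e
  induction hf using Submodule.span_induction generalizing e with
  | mem a ha =>
    obtain ⟨p, hp⟩ := hs a ha
    rw [homogeneousComponent_of_mem hp]
    split_ifs
    · exact Ideal.subset_span ha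
    · exact zero_mem _
  | zero => simp
  | add x y _ _ hx hy => rw [map_add]; exact add_mem (hx e) (hy e)
  | smul r x _ hx =>
    rw [smul_eq_mul, ← sum_homogeneousComponent r, Finset.sum_mul, map_sum]
    refine sum_mem fun i _ => ?_
    rcases lt_or_ge e i with hei | hei
    · rw [homogeneousComponent_mul_of_lt (homogeneousComponent_isHomogeneous i r) _ hei]
      exact zero_mem _
    · obtain ⟨e, rfl⟩ := Nat.exists_eq_add_of_le' hei
      rw [homogeneousComponent_add_mul (homogeneousComponent_isHomogeneous i r)]
      exact Ideal.mul_mem_left _ _ (hx e)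

theorem isHomogeneousIdeal_ofList {l : List (MvPolynomial σ k)}
    (hl : ∀ a ∈ l, ∃ p, a.IsHomogeneous p) : IsHomogeneousIdeal (Ideal.ofList l) :=
  isHomogeneousIdeal_span hl

theorem mem_of_homogeneousComponent_mem {I : Ideal (MvPolynomial σ k)} {f : MvPolynomial σ k}
    (h : ∀ e, homogeneousComponent e f ∈ I) : f ∈ I := by
  rw [← sum_homogeneousComponent f]
  exact sum_mem fun i _ => h i

theorem mem_or_exists_of_mem_sup_span {I : Ideal (MvPolynomial σ k)} (hI : IsHomogeneousIdeal I)
    {a f : MvPolynomial σ k} {p e : ℕ} (ha : a.IsHomogeneous p) (hf : f.IsHomogeneous e)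
    (h : f ∈ I ⊔ Ideal.span {a}) :
    f ∈ I ∨ ∃ e' c, e' + p = e ∧ IsHomogeneous c e' ∧ f - a * c ∈ I := by
  obtain ⟨i, hi, j, hj, hij⟩ := Submodule.mem_sup.1 h
  obtain ⟨c, rfl⟩ := Ideal.mem_span_singleton'.1 hj
  have hfe := homogeneousComponent_eq_self hf
  rw [← hij, map_add, mul_comm c] at hfe
  rcases lt_or_ge e p with hep | hep
  · left
    rw [homogeneousComponent_mul_of_lt ha _ hep, add_zero] at hfe
    rw [← hij, mul_comm c, ← hfe]
    exact hI i hi e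
  · right
    obtain ⟨e, rfl⟩ := Nat.exists_eq_add_of_le' hep
    rw [homogeneousComponent_add_mul ha] at hfe
    refine ⟨e, _, rfl, homogeneousComponent_isHomogeneous e c, ?_⟩
    rw [← hij, mul_comm c, ← hfe, add_sub_cancel_right]
    exact hI i hi _

/-- The product of a homogeneous `a` with `h` lies in a homogeneous ideal iff this holds
componentwise. -/
theorem mul_homogeneousComponent_mem {I : Ideal (MvPolynomial σ k)} (hI : IsHomogeneousIdeal I)
    {a h : MvPolynomial σ k} {p : ℕ} (ha : a.IsHomogeneous p) (hah : a * h ∈ I) (e : ℕ) :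
    a * homogeneousComponent e h ∈ I := by
  rw [← homogeneousComponent_add_mul ha]
  exact hI _ hah _

theorem IsRegOn.swap {I : Ideal (MvPolynomial σ k)} (hI : IsHomogeneousIdeal I)
    {a c : MvPolynomial σ k} (ha : ∃ p, 0 < p ∧ a.IsHomogeneous p)
    (hc : ∃ p, 0 < p ∧ c.IsHomogeneous p) {l : List (MvPolynomial σ k)}
    (h : IsRegOn I (a :: c :: l)) : IsRegOn I (c :: a :: l) := by
  obtain ⟨p, hp, ha⟩ := ha
  obtain ⟨q, hq, hc⟩ := hc
  obtain ⟨h1, h2, h3⟩ := h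
  have key : ∀ (e : ℕ) (f : MvPolynomial σ k), f.IsHomogeneous e → c * f ∈ I → f ∈ I := by
    intro e
    induction e using Nat.strong_induction_on with
    | _ e ih =>
      intro f hf hcf
      rcases mem_or_exists_of_mem_sup_span hI ha hf (h2 f (Ideal.mem_sup_left hcf)) with
        h | ⟨e', f', rfl, hf', h⟩
      · exact h
      · have : f' ∈ I := by
          refine ih e' (by omega) f' hf' (h1 _ ?_)
          have : a * (c * f') = c * f - c * (f - a * f') := by ring
          rw [this]
          exact sub_mem hcf (Ideal.mul_mem_left _ _ h)
        rw [← sub_add_cancel f (a * f')]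
        exact add_mem h (Ideal.mul_mem_left _ _ this)
  have key' : ∀ f, c * f ∈ I → f ∈ I := fun f hf => mem_of_homogeneousComponent_mem fun e =>
    key e _ (homogeneousComponent_isHomogeneous e f) (mul_homogeneousComponent_mem hI hc hf e)
  refine ⟨key', fun f hf => ?_, by rwa [sup_right_comm]⟩
  obtain ⟨i, hi, j, hj, hij⟩ := Submodule.mem_sup.1 hf
  obtain ⟨x, rfl⟩ := Ideal.mem_span_singleton'.1 hj
  have hx : x ∈ I ⊔ Ideal.span {a} := by
    refine h2 x ?_
    have : c * x = a * f - i := by rw [← hij]; ring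
    rw [this]
    exact sub_mem (Ideal.mem_sup_right (Ideal.mul_mem_right _ _ (Ideal.mem_span_singleton_self a)))
      (Ideal.mem_sup_left hi)
  obtain ⟨i', hi', j', hj', rfl⟩ := Submodule.mem_sup.1 hx
  obtain ⟨y, rfl⟩ := Ideal.mem_span_singleton'.1 hj'
  have : f - c * y ∈ I := by
    refine h1 _ ?_
    have : a * (f - c * y) = i + c * i' := by rw [mul_sub, ← hij]; ring
    rw [this]
    exact add_mem hi (Ideal.mul_mem_left _ _ hi')
  rw [← sub_add_cancel f (c * y)]
  exact add_mem (Ideal.mem_sup_left this)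
    (Ideal.mem_sup_right (Ideal.mul_mem_right _ _ (Ideal.mem_span_singleton_self c)))

theorem IsRegOn.perm {l l' : List (MvPolynomial σ k)} (hll : l.Perm l')
    {I : Ideal (MvPolynomial σ k)} (hI : IsHomogeneousIdeal I)
    (hl : ∀ a ∈ l, ∃ p, 0 < p ∧ a.IsHomogeneous p) (h : IsRegOn I l) : IsRegOn I l' := by
  induction hll generalizing I with
  | nil => exact h
  | cons a _ ih =>
    refine ⟨h.1, ih (hI.sup ?_) (fun c hc => hl c (List.mem_cons_of_mem _ hc)) h.2⟩
    obtain ⟨p, -, hp⟩ := hl a List.mem_cons_self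
    exact isHomogeneousIdeal_span fun c hc => ⟨p, by rwa [Set.mem_singleton_iff.1 hc]⟩
  | swap a c l =>
    exact h.swap hI (hl _ (by simp)) (hl _ (by simp))
  | trans h1 h2 ih1 ih2 =>
    exact ih2 hI (fun c hc => hl c (h1.mem_iff.2 hc)) (ih1 hI hl h)

theorem divMonomial_eq_zero_of_notMem_vars {j : σ} {p : MvPolynomial σ k} (hp : j ∉ p.vars) :
    p.divMonomial (Finsupp.single j 1) = 0 := by
  ext m
  rw [coeff_divMonomial, coeff_zero]
  by_contra h
  refine hp ((mem_vars_iff_mem_support _).2 ⟨_, mem_support_iff.2 h, ?_⟩)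
  simp

theorem mul_divMonomial_of_notMem_vars {j : σ} {p : MvPolynomial σ k} (hp : j ∉ p.vars)
    (q : MvPolynomial σ k) :
    (p * q).divMonomial (Finsupp.single j 1) = p * q.divMonomial (Finsupp.single j 1) := by
  classical
  conv_lhs => rw [← divMonomial_add_modMonomial_single q j]
  rw [mul_add, mul_left_comm, add_divMonomial, X_mul_divMonomial,
    divMonomial_eq_zero_of_notMem_vars (p := p * _), add_zero]
  intro h
  rcases Finset.mem_union.1 (vars_mul _ _ h) with h | h
  · exact hp h
  · obtain ⟨m, hm, hmj⟩ := (mem_vars_iff_mem_support _).1 h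
    rw [mem_support_iff] at hm
    refine hm (coeff_modMonomial_of_le _ ?_)
    rw [Finsupp.single_le_iff]
    exact Nat.one_le_iff_ne_zero.2 (Finsupp.mem_support_iff.1 hmj)

theorem X_pow_mul_mem_span_of_notMem_vars {j : σ} {s : Set (MvPolynomial σ k)}
    (hs : ∀ p ∈ s, j ∉ p.vars) (a : ℕ) {h : MvPolynomial σ k} (hh : X j ^ a * h ∈ Ideal.span s) :
    h ∈ Ideal.span s := by
  have key : ∀ f ∈ Ideal.span s, ∀ r, (r * f).divMonomial (Finsupp.single j 1) ∈ Ideal.span s := by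
    intro f hf
    induction hf using Submodule.span_induction with
    | mem p hp =>
      intro r
      rw [mul_comm, mul_divMonomial_of_notMem_vars (hs p hp)]
      exact Ideal.mul_mem_right _ _ (Ideal.subset_span hp)
    | zero => simp
    | add x y _ _ hx hy =>
      intro r
      rw [mul_add, add_divMonomial]
      exact add_mem (hx r) (hy r)
    | smul c x _ hx =>
      intro r
      rw [smul_eq_mul, ← mul_assoc]
      exact hx _
  induction a with
  | zero => simpa using hh
  | succ a ih =>
    refine ih ?_
    have := key _ hh 1
    rwa [one_mul, pow_succ', mul_assoc, X_mul_divMonomial] at this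

theorem isRegOn_map_X_pow (a : σ → ℕ) {l : List σ} (hl : l.Nodup) {s : Set (MvPolynomial σ k)}
    (hs : ∀ j ∈ l, ∀ p ∈ s, j ∉ p.vars) :
    IsRegOn (Ideal.span s) (l.map fun j => X j ^ a j) := by
  induction l generalizing s with
  | nil => trivial
  | cons j l ih =>
    rw [List.nodup_cons] at hl
    refine ⟨fun h hh => X_pow_mul_mem_span_of_notMem_vars (hs j (by simp)) _ hh, ?_⟩
    rw [← Ideal.span_union]
    refine ih hl.2 fun i hi p hp => ?_
    rcases hp with hp | hp
    · exact hs i (List.mem_cons_of_mem _ hi) p hp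
    · rw [Set.mem_singleton_iff.1 hp]
      intro hv
      classical
      obtain ⟨m, hm, hmi⟩ := (mem_vars_iff_mem_support _).1 hv
      beta_reduce at hm
      rw [X_pow_eq_monomial] at hm
      have := support_monomial_subset hm
      rw [Finset.mem_singleton] at this
      subst this
      have := Finsupp.support_single_subset hmi
      rw [Finset.mem_singleton] at this
      exact hl.1 (this ▸ hi)

end Homogeneous

section Hilbert

variable {σ k : Type*} [Field k]

/-- The degree `e` part of an ideal of the polynomial ring. -/
noncomputable def gradedPiece (I : Ideal (MvPolynomial σ k)) (e : ℕ) :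
    Submodule k (MvPolynomial σ k) :=
  homogeneousSubmodule σ k e ⊓ I.restrictScalars k

theorem mem_gradedPiece {I : Ideal (MvPolynomial σ k)} {e : ℕ} {f : MvPolynomial σ k} :
    f ∈ gradedPiece I e ↔ f.IsHomogeneous e ∧ f ∈ I := Iff.rfl

instance [Finite σ] (e : ℕ) : FiniteDimensional k (homogeneousSubmodule σ k e) :=
  Module.Finite.iff_fg.2 (homogeneousSubmodule_fg σ k e)

instance [Finite σ] (I : Ideal (MvPolynomial σ k)) (e : ℕ) :
    FiniteDimensional k (gradedPiece I e) :=
  Submodule.finiteDimensional_of_le (inf_le_left (b := I.restrictScalars k))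

theorem finrank_gradedPiece_sup [Finite σ] {I : Ideal (MvPolynomial σ k)}
    (hI : IsHomogeneousIdeal I)
    {a : MvPolynomial σ k} {p : ℕ} (ha : a.IsHomogeneous p) (hreg : ∀ h, a * h ∈ I → h ∈ I)
    (e : ℕ) :
    Module.finrank k (gradedPiece (I ⊔ Ideal.span {a}) (e + p)) +
      Module.finrank k (gradedPiece I e) =
    Module.finrank k (homogeneousSubmodule σ k e) + Module.finrank k (gradedPiece I (e + p)) := by
  let φ : (homogeneousSubmodule σ k e × gradedPiece I (e + p)) →ₗ[k] MvPolynomial σ k :=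
    LinearMap.coprod ((LinearMap.mulLeft k a).comp (Submodule.subtype _)) (Submodule.subtype _)
  have hφ (x) : φ x = a * x.1.1 + x.2.1 := rfl
  have hrange : LinearMap.range φ = gradedPiece (I ⊔ Ideal.span {a}) (e + p) := by
    ext f
    constructor
    · rintro ⟨⟨⟨x, hx⟩, ⟨y, hy⟩⟩, rfl⟩
      refine mem_gradedPiece.2 ⟨?_, add_mem (Ideal.mem_sup_right
        (Ideal.mul_mem_right _ _ (Ideal.mem_span_singleton_self a))) (Ideal.mem_sup_left hy.2)⟩
      have := ha.mul hx
      rw [add_comm p] at this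
      exact this.add hy.1
    · intro hf
      obtain ⟨hf1, hf2⟩ := mem_gradedPiece.1 hf
      rcases mem_or_exists_of_mem_sup_span hI ha hf1 hf2 with h | ⟨e', c, he, hc, h⟩
      · exact ⟨(0, ⟨f, hf1, h⟩), by simp [hφ]⟩
      · obtain rfl : e' = e := by omega
        refine ⟨(⟨c, hc⟩, ⟨f - a * c, hf1.sub ?_, h⟩), by simp [hφ]⟩
        rw [add_comm]
        exact ha.mul hc
  let ψ : gradedPiece I e →ₗ[k] LinearMap.ker φ :=
    { toFun := fun x => ⟨(⟨x.1, x.2.1⟩, ⟨- (a * x.1), by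
          rw [add_comm]
          exact (ha.mul x.2.1).neg, neg_mem (Ideal.mul_mem_left _ _ x.2.2)⟩), by
            rw [LinearMap.mem_ker, hφ]
            simp⟩
      map_add' := fun x y => by
        ext1
        refine Prod.ext rfl (Subtype.ext ?_)
        change -(a * (x.1 + y.1)) = -(a * x.1) + -(a * y.1)
        ring
      map_smul' := fun c x => by
        ext1
        refine Prod.ext rfl (Subtype.ext ?_)
        change -(a * (c • x.1)) = c • -(a * x.1)
        simp }
  have hψ : Function.Bijective ψ := by
    constructor
    · intro x y hxy
      exact Subtype.ext (congrArg (fun z : LinearMap.ker φ => z.1.1.1) hxy)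
    · rintro ⟨⟨⟨x, hx⟩, ⟨y, hy⟩⟩, h⟩
      rw [LinearMap.mem_ker, hφ] at h
      have h0 : y = -(a * x) := eq_neg_of_add_eq_zero_right h
      refine ⟨⟨x, hx, hreg _ ?_⟩, ?_⟩
      · rw [← neg_neg (a * x), ← h0]
        exact neg_mem hy.2
      · subst h0
        rfl
  have h1 := LinearMap.finrank_range_add_finrank_ker φ
  rw [← (LinearEquiv.ofBijective ψ hψ).finrank_eq, hrange, Module.finrank_prod] at h1
  exact h1

theorem gradedPiece_sup_of_lt {I : Ideal (MvPolynomial σ k)} (hI : IsHomogeneousIdeal I)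
    {a : MvPolynomial σ k} {p e : ℕ} (ha : a.IsHomogeneous p) (hep : e < p) :
    gradedPiece (I ⊔ Ideal.span {a}) e = gradedPiece I e := by
  ext f
  rw [mem_gradedPiece, mem_gradedPiece]
  refine and_congr_right fun hf => ⟨fun h => ?_, fun h => Ideal.mem_sup_left h⟩
  rcases mem_or_exists_of_mem_sup_span hI ha hf h with h | ⟨e', c, he, hc, h⟩
  · exact h
  · omega

theorem finrank_gradedPiece_sup_ofList_eq [Finite σ] {l l' : List (MvPolynomial σ k)}
    (hll : List.Forall₂ (fun a c => ∃ p, a.IsHomogeneous p ∧ c.IsHomogeneous p) l l')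
    {I I' : Ideal (MvPolynomial σ k)} (hI : IsHomogeneousIdeal I) (hI' : IsHomogeneousIdeal I')
    (hl : IsRegOn I l) (hl' : IsRegOn I' l')
    (h : ∀ e, Module.finrank k (gradedPiece I e) = Module.finrank k (gradedPiece I' e)) (e : ℕ) :
    Module.finrank k (gradedPiece (I ⊔ Ideal.ofList l) e) =
      Module.finrank k (gradedPiece (I' ⊔ Ideal.ofList l') e) := by
  induction hll generalizing I I' with
  | nil => rw [Ideal.ofList_nil, sup_bot_eq, sup_bot_eq, h]
  | @cons a c l l' hac _ ih =>
    obtain ⟨p, ha, hc⟩ := hac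
    rw [← sup_span_sup_ofList, ← sup_span_sup_ofList]
    refine ih (hI.sup (isHomogeneousIdeal_span ?_)) (hI'.sup (isHomogeneousIdeal_span ?_))
      hl.2 hl'.2 fun e => ?_
    · rintro _ rfl
      exact ⟨p, ha⟩
    · rintro _ rfl
      exact ⟨p, hc⟩
    · rcases lt_or_ge e p with hep | hep
      · rw [gradedPiece_sup_of_lt hI ha hep, gradedPiece_sup_of_lt hI' hc hep, h]
      · obtain ⟨e, rfl⟩ := Nat.exists_eq_add_of_le' hep
        have h1 := finrank_gradedPiece_sup hI ha hl.1 e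
        have h2 := finrank_gradedPiece_sup hI' hc hl'.1 e
        have h3 := h e
        have h4 := h (e + p)
        omega

theorem mem_ofList_map_X_pow_iff {l : List σ} {a : σ → ℕ} {f : MvPolynomial σ k} :
    f ∈ Ideal.ofList (l.map fun i => X i ^ a i : List (MvPolynomial σ k)) ↔
      ∀ m ∈ f.support, ∃ i ∈ l, a i ≤ m i := by
  have : Ideal.ofList (l.map fun i => X i ^ a i : List (MvPolynomial σ k)) =
      Ideal.span ((fun s => monomial s (1 : k)) ''
        ((fun i => Finsupp.single i (a i)) '' {i | i ∈ l})) := by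
    rw [Set.image_image, Ideal.ofList]
    congr 1
    ext p
    simp [X_pow_eq_monomial]
  rw [this, mem_ideal_span_monomial_image]
  simp [Finsupp.single_le_iff]

/-- The graded pieces of a complete intersection of `n` forms of degrees `p i` vanish in degrees
above `∑ (p i - 1)`. -/
theorem mem_ofList_of_sum_lt [Fintype σ] {l : List σ} (hl : l.Nodup) (hl' : ∀ i, i ∈ l)
    {f : σ → MvPolynomial σ k} {p : σ → ℕ}
    (hf : ∀ i, (f i).IsHomogeneous (p i)) (hreg : IsRegOn ⊥ (l.map f)) {e : ℕ}
    (he : ∑ i, (p i - 1) < e) {h : MvPolynomial σ k} (hh : h.IsHomogeneous e) :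
    h ∈ Ideal.ofList (l.map f) := by
  have hX : IsRegOn (⊥ : Ideal (MvPolynomial σ k)) (l.map fun i => X i ^ p i) := by
    rw [← Ideal.span_empty]
    exact isRegOn_map_X_pow p hl (by simp)
  have h1 := finrank_gradedPiece_sup_ofList_eq (l := l.map f) (l' := l.map fun i => X i ^ p i)
    (by
      rw [List.forall₂_map_left_iff, List.forall₂_map_right_iff, List.forall₂_same]
      exact fun i _ => ⟨p i, hf i, isHomogeneous_X_pow i _⟩)
    isHomogeneousIdeal_bot isHomogeneousIdeal_bot hreg hX (fun _ => rfl) e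
  rw [bot_sup_eq, bot_sup_eq] at h1
  have h2 : gradedPiece (Ideal.ofList (l.map fun i => X i ^ p i)) e =
      homogeneousSubmodule σ k e := by
    refine inf_eq_left.2 fun q hq => mem_ofList_map_X_pow_iff.2 fun m hm => ?_
    by_contra! hlt
    have hd : m.degree = e := (hq.degree_eq_sum_deg_support hm).symm
    rw [Finsupp.degree_eq_sum] at hd
    have : ∑ i, m i ≤ ∑ i, (p i - 1) := Finset.sum_le_sum fun i _ => by
      have := hlt i (hl' i)
      omega
    omega
  rw [h2] at h1
  have h3 := Submodule.eq_of_le_of_finrank_eq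
    (inf_le_left : gradedPiece (Ideal.ofList (l.map f)) e ≤ _) h1
  have h4 : h ∈ homogeneousSubmodule σ k e := hh
  rw [← h3] at h4
  exact h4.2

/-- A complete intersection of `n` forms of degrees `p i` has nonzero elements in degree
`∑ (p i - 1)`. -/
theorem exists_notMem_ofList [Fintype σ] {l : List σ} (hl : l.Nodup)
    {f : σ → MvPolynomial σ k} {p : σ → ℕ} (hp : ∀ i, 0 < p i)
    (hf : ∀ i, (f i).IsHomogeneous (p i)) (hreg : IsRegOn ⊥ (l.map f)) :
    ∃ h : MvPolynomial σ k, h.IsHomogeneous (∑ i, (p i - 1)) ∧ h ∉ Ideal.ofList (l.map f) := by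
  set e := ∑ i, (p i - 1) with he
  by_contra! hcon
  have hX : IsRegOn (⊥ : Ideal (MvPolynomial σ k)) (l.map fun i => X i ^ p i) := by
    rw [← Ideal.span_empty]
    exact isRegOn_map_X_pow p hl (by simp)
  have h1 := finrank_gradedPiece_sup_ofList_eq (l := l.map f) (l' := l.map fun i => X i ^ p i)
    (by
      rw [List.forall₂_map_left_iff, List.forall₂_map_right_iff, List.forall₂_same]
      exact fun i _ => ⟨p i, hf i, isHomogeneous_X_pow i _⟩)
    isHomogeneousIdeal_bot isHomogeneousIdeal_bot hreg hX (fun _ => rfl) e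
  rw [bot_sup_eq, bot_sup_eq] at h1
  have h2 : gradedPiece (Ideal.ofList (l.map f)) e = homogeneousSubmodule σ k e :=
    inf_eq_left.2 fun q hq => hcon q hq
  rw [h2] at h1
  have h3 := Submodule.eq_of_le_of_finrank_eq
    (inf_le_left : gradedPiece (Ideal.ofList (l.map fun i => X i ^ p i)) e ≤ _) h1.symm
  let m : σ →₀ ℕ := Finsupp.equivFunOnFinite.symm fun i => p i - 1
  have h4 : monomial m (1 : k) ∈ homogeneousSubmodule σ k e :=
    isHomogeneous_monomial _ (by rw [Finsupp.degree_eq_sum]; rfl)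
  rw [← h3] at h4
  obtain ⟨i, -, hi⟩ := mem_ofList_map_X_pow_iff.1 h4.2 m
    (by classical simp [mem_support_iff, coeff_monomial])
  have := hp i
  have : p i ≤ p i - 1 := hi
  omega

end Hilbert

section Linkage

variable {σ k : Type*} [Field k]

theorem IsRegOn.append_of_mem_ofList {xs ys l : List (MvPolynomial σ k)}
    (hlen : ys.length = xs.length) (hyx : ∀ y ∈ ys, y ∈ Ideal.ofList xs)
    (hxs : ∀ a ∈ xs, ∃ p, 0 < p ∧ a.IsHomogeneous p)
    (hys : ∀ a ∈ ys, ∃ p, 0 < p ∧ a.IsHomogeneous p)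
    (hl : ∀ a ∈ l, ∃ p, 0 < p ∧ a.IsHomogeneous p)
    {I : Ideal (MvPolynomial σ k)} (hI : IsHomogeneousIdeal I)
    (hx : IsRegOn I xs) (hy : IsRegOn I (l ++ ys)) : IsRegOn I (l ++ xs) := by
  induction l generalizing I with
  | nil => exact hx
  | cons c l ih =>
    have hc := hl c List.mem_cons_self
    have hl' : ∀ a ∈ l, ∃ p, 0 < p ∧ a.IsHomogeneous p :=
      fun a ha => hl a (List.mem_cons_of_mem _ ha)
    have h1 : IsRegOn I (ys ++ c :: l) := hy.perm List.perm_append_comm hI (by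
      intro a ha
      rcases List.mem_append.1 ha with h | h
      exacts [hl a h, hys a h])
    rw [isRegOn_append] at h1
    obtain ⟨u, -, hu⟩ := exists_colon_generator I hlen hyx h1.1 hx
    have h2 : IsRegOn I (xs ++ [c]) := by
      rw [isRegOn_append]
      refine ⟨hx, fun h hh => ?_, trivial⟩
      rw [← hu] at hh ⊢
      exact h1.2.1 _ (by rwa [← mul_assoc])
    have h3 : IsRegOn I (c :: xs) := h2.perm (List.perm_append_comm (l₂ := [c])) hI (by
      intro a ha
      rcases List.mem_append.1 ha with h | h
      · exact hxs a h
      · rw [List.mem_singleton.1 h]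
        exact hc)
    refine ⟨h3.1, ih hl' (hI.sup ?_) h3.2 hy.2⟩
    obtain ⟨p, -, hp⟩ := hc
    exact isHomogeneousIdeal_span fun a ha => ⟨p, by rwa [Set.mem_singleton_iff.1 ha]⟩

theorem sub_C_coeff_zero_mem (f : MvPolynomial σ k) :
    f - C (coeff 0 f) ∈ Ideal.span (Set.range (X : σ → MvPolynomial σ k)) := by
  classical
  rw [← Set.image_univ, mem_ideal_span_X_image]
  intro m hm
  by_contra! h
  obtain rfl : m = 0 := Finsupp.ext fun i => h i trivial
  simp [mem_support_iff] at hm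

/-- The perfect pairing in a standard graded quotient with one-dimensional socle. -/
theorem exists_mul_notMem_of_socle {A : Ideal (MvPolynomial σ k)} (hA : IsHomogeneousIdeal A)
    {w : MvPolynomial σ k}
    (hw : ∀ h, (∀ p ∈ Ideal.span (Set.range X), h * p ∈ A) ↔ ∃ r, h - r * w ∈ A) {s : ℕ}
    (hs : ∀ e, s < e → ∀ h : MvPolynomial σ k, h.IsHomogeneous e → h ∈ A)
    (hz : ∃ z : MvPolynomial σ k, z.IsHomogeneous s ∧ z ∉ A)
    {t : MvPolynomial σ k} {c : ℕ} (ht : t.IsHomogeneous c) (htA : t ∉ A) :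
    ∃ e r, c + e = s ∧ IsHomogeneous r e ∧ t * r ∉ A := by
  classical
  obtain ⟨z, hzs, hzA⟩ := hz
  have soc : ∀ h : MvPolynomial σ k, (∀ i, h * X i ∈ A) → ∃ a : k, h - C a * w ∈ A := by
    intro h hh
    obtain ⟨r, hr⟩ := (hw h).1 fun p hp => by
      induction hp using Submodule.span_induction with
      | mem x hx =>
        obtain ⟨i, rfl⟩ := hx
        exact hh i
      | zero => simp
      | add x y _ _ hx hy => rw [mul_add]; exact add_mem hx hy
      | smul a x _ hx => rw [smul_eq_mul, mul_left_comm]; exact Ideal.mul_mem_left _ _ hx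
    refine ⟨coeff 0 r, ?_⟩
    have h1 : w * (r - C (coeff 0 r)) ∈ A :=
      (hw w).2 ⟨1, by simp⟩ _ (sub_C_coeff_zero_mem r)
    have : h - C (coeff 0 r) * w = (h - r * w) + w * (r - C (coeff 0 r)) := by ring
    rw [this]
    exact add_mem hr h1
  let Q : ℕ → Prop := fun e => ∃ r, IsHomogeneous r e ∧ t * r ∉ A
  have hQ0 : Q 0 := ⟨1, isHomogeneous_one _ _, by simpa using htA⟩
  have hQs : ∀ e, Q e → e ≤ s := by
    rintro e ⟨r, hr, hrA⟩
    by_contra! hlt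
    exact hrA (hs _ (by omega) _ (ht.mul hr))
  obtain ⟨r, hr, hrA⟩ : Q (Nat.findGreatest Q s) := Nat.findGreatest_spec (Nat.zero_le _) hQ0
  have hmax : ∀ i, t * r * X i ∈ A := by
    intro i
    by_contra hcon
    have hQ : Q (Nat.findGreatest Q s + 1) :=
      ⟨r * X i, hr.mul (isHomogeneous_X _ i), by rwa [← mul_assoc]⟩
    exact absurd (Nat.le_findGreatest (hQs _ hQ) hQ) (by omega)
  obtain ⟨a, ha⟩ := soc _ hmax
  obtain ⟨a', ha'⟩ := soc z fun i => hs _ (Nat.lt_succ_self s) _ (hzs.mul (isHomogeneous_X _ i))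
  have ha0 : a ≠ 0 := by
    rintro rfl
    exact hrA (by simpa using ha)
  have hza : z - C (a' * a⁻¹) * (t * r) ∈ A := by
    have : z - C (a' * a⁻¹) * (t * r) =
        (z - C a' * w) - C (a' * a⁻¹) * (t * r - C a * w) := by
      have : (C a' : MvPolynomial σ k) = C (a' * a⁻¹) * C a := by
        rw [← C_mul, inv_mul_cancel_right₀ ha0]
      rw [this]
      ring
    rw [this]
    exact sub_mem ha' (Ideal.mul_mem_left _ _ ha)
  refine ⟨_, r, ?_, hr, hrA⟩
  by_contra hne
  refine hzA ?_
  have := hA _ hza s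
  rwa [map_sub, homogeneousComponent_eq_self hzs, homogeneousComponent_C_mul,
    homogeneousComponent_of_mem (ht.mul hr), if_neg (Ne.symm hne), mul_zero, sub_zero] at this

theorem homogeneousComponent_mem_span_X_mul {B : Set σ} {y : MvPolynomial σ k}
    (hy : y ∈ Ideal.span (X '' B : Set (MvPolynomial σ k))) (e : ℕ) :
    homogeneousComponent (e + 1) y ∈
      Ideal.span {f | ∃ i ∈ B, ∃ q : MvPolynomial σ k, q.IsHomogeneous e ∧ f = X i * q} := by
  have key : ∀ r, homogeneousComponent (e + 1) (y * r) ∈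
      Ideal.span {f | ∃ i ∈ B, ∃ q : MvPolynomial σ k, q.IsHomogeneous e ∧ f = X i * q} := by
    induction hy using Submodule.span_induction with
    | mem x hx =>
      obtain ⟨i, hi, rfl⟩ := hx
      intro r
      rw [homogeneousComponent_add_mul (isHomogeneous_X k i)]
      exact Ideal.subset_span ⟨i, hi, _, homogeneousComponent_isHomogeneous e r, rfl⟩
    | zero => simp
    | add x y _ _ hx hy =>
      intro r
      rw [add_mul, map_add]
      exact add_mem (hx r) (hy r)
    | smul a x _ hx =>
      intro r
      rw [smul_eq_mul, mul_comm a, mul_assoc]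
      exact hx _
  simpa using key 1

theorem mem_sup_pow_mul_span {B : Set σ} {A : Ideal (MvPolynomial σ k)}
    (hA : IsHomogeneousIdeal A) {τ : ℕ}
    (hτ : ∀ e, τ < e → ∀ h : MvPolynomial σ k, h.IsHomogeneous e →
      h ∈ A ⊔ Ideal.span (X '' B)) (j : ℕ) {f : MvPolynomial σ k} (hf : f.IsHomogeneous (τ + j)) :
    f ∈ A ⊔ Ideal.span (X '' B) ^ j * Ideal.span {r | r.IsHomogeneous τ} := by
  induction j generalizing f with
  | zero =>
    rw [pow_zero, Ideal.one_eq_top, Ideal.top_mul]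
    exact Ideal.mem_sup_right (Ideal.subset_span hf)
  | succ j ih =>
    obtain ⟨a, ha, y, hy, hay⟩ := Submodule.mem_sup.1 (hτ _ (by omega) _ hf)
    rw [← homogeneousComponent_eq_self hf, ← hay, map_add]
    refine add_mem (Ideal.mem_sup_left (hA _ ha _)) ?_
    refine (Ideal.span_le.2 ?_) (homogeneousComponent_mem_span_X_mul hy (τ + j))
    rintro _ ⟨i, hi, q, hq, rfl⟩
    obtain ⟨a, ha, y, hy, hay⟩ := Submodule.mem_sup.1 (ih hq)
    rw [← hay, mul_add]
    refine add_mem (Ideal.mem_sup_left (Ideal.mul_mem_left _ _ ha)) (Ideal.mem_sup_right ?_)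
    rw [pow_succ', mul_assoc]
    exact Ideal.mul_mem_mul (Ideal.subset_span ⟨i, hi, rfl⟩) hy

theorem span_X_pow_le_span {B : Set σ} (j : ℕ) :
    Ideal.span (X '' B : Set (MvPolynomial σ k)) ^ j ≤
      Ideal.span {t | t.IsHomogeneous j ∧ t ∈ Ideal.span (X '' B) ^ j} := by
  induction j with
  | zero =>
    intro f _
    rw [← mul_one f]
    exact Ideal.mul_mem_left _ _ (Ideal.subset_span ⟨isHomogeneous_one _ _, by simp⟩)
  | succ j ih =>
    rw [pow_succ]
    refine (Ideal.mul_mono ih le_rfl).trans ?_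
    rw [Ideal.span_mul_span']
    refine Ideal.span_mono ?_
    rintro _ ⟨t, ht, _, ⟨i, hi, rfl⟩, rfl⟩
    exact ⟨ht.1.mul (isHomogeneous_X _ i),
      Ideal.mul_mem_mul ht.2 (Ideal.subset_span ⟨i, hi, rfl⟩)⟩

end Linkage

section Generator

variable {σ k : Type*} [Field k]

theorem mem_of_mul_pow_mem {B : Set σ} {A : Ideal (MvPolynomial σ k)}
    (hA : IsHomogeneousIdeal A) {τ M : ℕ}
    (hτ : ∀ e, τ < e → ∀ h : MvPolynomial σ k, h.IsHomogeneous e →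
      h ∈ A ⊔ Ideal.span (X '' B))
    (hpair : ∀ (t : MvPolynomial σ k) (c : ℕ), t.IsHomogeneous c → t ∉ A →
      ∃ e r, c + e = M + τ ∧ IsHomogeneous r e ∧ t * r ∉ A)
    {t : MvPolynomial σ k} {c j : ℕ} (ht : t.IsHomogeneous c) (hc : c + j = M)
    (h : ∀ q ∈ Ideal.span (X '' B : Set (MvPolynomial σ k)) ^ j, t * q ∈ A) : t ∈ A := by
  by_contra htA
  obtain ⟨e, r, he, hr, hrA⟩ := hpair t c ht htA
  have hej : e = τ + j := by omega
  rw [hej] at hr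
  refine hrA ?_
  have key := mem_sup_pow_mul_span hA hτ j hr
  obtain ⟨a, ha, y, hy, hay⟩ := Submodule.mem_sup.1 key
  rw [← hay, mul_add]
  have hy' := Ideal.mul_le_left hy
  exact add_mem (Ideal.mul_mem_left _ _ ha) (h y hy')

theorem mul_mem_of_forall_X_mul_mem {I : Ideal (MvPolynomial σ k)} {r : MvPolynomial σ k}
    (h : ∀ i, X i * r ∈ I) {p : MvPolynomial σ k}
    (hp : p ∈ Ideal.span (Set.range (X : σ → MvPolynomial σ k))) : p * r ∈ I := by
  induction hp using Submodule.span_induction with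
  | mem x hx =>
    obtain ⟨i, rfl⟩ := hx
    exact h i
  | zero => simp
  | add x y _ _ hx hy => rw [add_mul]; exact add_mem hx hy
  | smul a x _ hx => rw [smul_eq_mul, mul_assoc]; exact Ideal.mul_mem_left _ _ hx

/-- A polynomial with nonzero constant term is invertible modulo an ideal containing all forms of
large degree. -/
theorem exists_mul_sub_one_mem {Q : Ideal (MvPolynomial σ k)} {τ : ℕ}
    (hQ : ∀ e, τ < e → ∀ h : MvPolynomial σ k, h.IsHomogeneous e → h ∈ Q)
    {c : MvPolynomial σ k} (hc : coeff 0 c ≠ 0) : ∃ e, e * c - 1 ∈ Q := by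
  set c' := c - C (coeff 0 c) with hc'
  have key : ∀ j e (r : MvPolynomial σ k), τ + 1 ≤ e + j → r.IsHomogeneous e → c' ^ j * r ∈ Q := by
    intro j
    induction j with
    | zero =>
      intro e r he hr
      exact Ideal.mul_mem_left _ _ (hQ e (by omega) r hr)
    | succ j ih =>
      intro e r he hr
      have : c' * (c' ^ j * r) ∈ Q := by
        refine mul_mem_of_forall_X_mul_mem (fun i => ?_) (sub_C_coeff_zero_mem c)
        rw [mul_left_comm]
        exact ih (1 + e) _ (by omega) ((isHomogeneous_X _ i).mul hr)
      rwa [pow_succ', mul_assoc]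
  have hnil : IsNilpotent (Ideal.Quotient.mk Q c') := by
    refine ⟨τ + 1, ?_⟩
    rw [← map_pow, Ideal.Quotient.eq_zero_iff_mem]
    simpa using key (τ + 1) 0 1 (by omega) (isHomogeneous_one _ _)
  have hunit : IsUnit (Ideal.Quotient.mk Q (C (coeff 0 c))) :=
    ((isUnit_iff_ne_zero.2 hc).map (C : k →+* MvPolynomial σ k)).map _
  have h := hnil.isUnit_add_left_of_commute hunit (Commute.all _ _)
  rw [← map_add, hc', add_sub_cancel] at h
  obtain ⟨y, hy⟩ := h.exists_left_inv
  obtain ⟨e, rfl⟩ := Ideal.Quotient.mk_surjective y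
  refine ⟨e, ?_⟩
  rwa [← Ideal.Quotient.eq, map_mul, map_one]

theorem exists_generator_homogeneous {B : Set σ} {A G : Ideal (MvPolynomial σ k)}
    (hA : IsHomogeneousIdeal A) (hGA : G ≤ A) {τ M : ℕ}
    (hτ : ∀ e, τ < e → ∀ h : MvPolynomial σ k, h.IsHomogeneous e →
      h ∈ G ⊔ Ideal.span (X '' B))
    (hz : ∃ z : MvPolynomial σ k, z.IsHomogeneous (M + τ) ∧ z ∉ A)
    (hM : Ideal.span (X '' B) ^ (M + 1) ≤ A) {u : MvPolynomial σ k}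
    (hu : ∀ h, (∀ p ∈ Ideal.span (X '' B), h * p ∈ A) → ∃ r, h - r * u ∈ A)
    (hu' : ∀ h, h * u ∈ A ↔ h ∈ G ⊔ Ideal.span (X '' B)) :
    ∃ v : MvPolynomial σ k, v ∈ Ideal.span (X '' B) ^ M ∧
      (∀ h, h * v ∈ A → h ∈ G ⊔ Ideal.span (X '' B)) ∧
      ∀ t ∈ Ideal.span (X '' B) ^ M, t.IsHomogeneous M → ∃ a : k, t - C a * v ∈ A := by
  set P := Ideal.span (X '' B : Set (MvPolynomial σ k)) with hP
  have hτ' : ∀ e, τ < e → ∀ h : MvPolynomial σ k, h.IsHomogeneous e → h ∈ A ⊔ P :=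
    fun e he h hh => sup_le_sup_right hGA P (hτ e he h hh)
  obtain ⟨v, r, hvh, hvP, hr, hvr⟩ : ∃ v r : MvPolynomial σ k, v.IsHomogeneous M ∧ v ∈ P ^ M ∧
      r.IsHomogeneous τ ∧ v * r ∉ A := by
    by_contra! hcon
    obtain ⟨z, hzh, hzA⟩ := hz
    rw [add_comm] at hzh
    have h1 : P ^ M * Ideal.span {r | r.IsHomogeneous τ} ≤ A := by
      refine (Ideal.mul_mono (span_X_pow_le_span M) le_rfl).trans ?_
      rw [Ideal.span_mul_span', Ideal.span_le]
      rintro _ ⟨t, ht, r, hr, rfl⟩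
      exact hcon t r ht.1 ht.2 hr
    exact hzA ((sup_le le_rfl h1) (mem_sup_pow_mul_span hA hτ' M hzh))
  have hkill : ∀ t ∈ P ^ M, ∃ r, t - r * u ∈ A := fun t ht => hu t fun p hp => by
    refine hM ?_
    rw [pow_succ]
    exact Ideal.mul_mem_mul ht hp
  obtain ⟨c, hc⟩ := hkill v hvP
  have hc0 : coeff 0 c ≠ 0 := by
    intro h0
    refine hvr ?_
    have h1 : c * r ∈ G ⊔ P := by
      refine mul_mem_of_forall_X_mul_mem (fun i => ?_) (by simpa [h0] using sub_C_coeff_zero_mem c)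
      exact hτ (1 + τ) (by omega) _ ((isHomogeneous_X _ i).mul hr)
    have : v * r = (v - c * u) * r + c * r * u := by ring
    rw [this]
    exact add_mem (Ideal.mul_mem_right _ _ hc) ((hu' _).2 h1)
  obtain ⟨e, he⟩ := exists_mul_sub_one_mem hτ hc0
  have hue : u - e * v ∈ A := by
    have : u - e * v = -((e * c - 1) * u) - e * (v - c * u) := by ring
    rw [this]
    exact sub_mem (neg_mem ((hu' _).2 he)) (Ideal.mul_mem_left _ _ hc)
  refine ⟨v, hvP, fun h hh => ?_, fun t ht htM => ?_⟩
  · have h1 : h * c ∈ G ⊔ P := by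
      rw [← hu']
      have : h * c * u = h * v - h * (v - c * u) := by ring
      rw [this]
      exact sub_mem hh (Ideal.mul_mem_left _ _ hc)
    have : h = e * (h * c) - h * (e * c - 1) := by ring
    rw [this]
    exact sub_mem (Ideal.mul_mem_left _ _ h1) (Ideal.mul_mem_left _ _ he)
  · obtain ⟨s, hs⟩ := hkill t ht
    refine ⟨coeff 0 (s * e), ?_⟩
    have h1 : t - v * (s * e) ∈ A := by
      have : t - v * (s * e) = (t - s * u) + s * (u - e * v) := by ring
      rw [this]
      exact add_mem hs (Ideal.mul_mem_left _ _ hue)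
    have h2 := hA _ h1 (0 + M)
    rwa [map_sub, homogeneousComponent_add_mul hvh, zero_add, homogeneousComponent_eq_self htM,
      homogeneousComponent_zero, mul_comm] at h2

theorem mem_span_X_pow_iff {B : Finset σ} {c : ℕ} {f : MvPolynomial σ k} :
    f ∈ Ideal.span (X '' (B : Set σ)) ^ c ↔ ∀ m ∈ f.support, c ≤ ∑ i ∈ B, m i := by
  classical
  have hspan : Ideal.span (X '' (B : Set σ) : Set (MvPolynomial σ k)) ^ c =
      Ideal.span ((fun m => monomial m (1 : k)) '' {m | c ≤ ∑ i ∈ B, m i}) := by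
    induction c with
    | zero =>
      rw [pow_zero, Ideal.one_eq_top, eq_comm, Ideal.eq_top_iff_one]
      exact Ideal.subset_span ⟨0, by simp, rfl⟩
    | succ c ih =>
      rw [pow_succ, ih, Ideal.span_mul_span']
      apply le_antisymm <;> rw [Ideal.span_le]
      · rintro _ ⟨_, ⟨m, hm, rfl⟩, _, ⟨i, hi, rfl⟩, rfl⟩
        refine Ideal.subset_span ⟨m + Finsupp.single i 1, ?_, ?_⟩
        · have h1 : ∑ j ∈ B, (Finsupp.single i 1 : σ →₀ ℕ) j = 1 := by
            simp [Finsupp.single_apply, Finset.mem_coe.1 hi]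
          have h2 : c ≤ ∑ j ∈ B, m j := hm
          simp only [Set.mem_ofPred_eq, Finsupp.add_apply, Finset.sum_add_distrib, h1]
          omega
        · simp [X, monomial_mul]
      · rintro _ ⟨m, hm, rfl⟩
        have hm : c + 1 ≤ ∑ j ∈ B, m j := hm
        obtain ⟨i, hi, hmi⟩ : ∃ i ∈ B, m i ≠ 0 := by
          by_contra! hcon
          rw [Finset.sum_eq_zero hcon] at hm
          omega
        have hle : Finsupp.single i 1 ≤ m := by
          rw [Finsupp.single_le_iff]
          omega
        refine Ideal.subset_span ⟨monomial (m - Finsupp.single i 1) 1,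
          ⟨_, ?_, rfl⟩, X i, ⟨i, hi, rfl⟩, ?_⟩
        · have h1 : ∑ j ∈ B, (Finsupp.single i 1 : σ →₀ ℕ) j = 1 := by
            simp [Finsupp.single_apply, hi]
          have h2 : ∑ j ∈ B, m j = ∑ j ∈ B, (m - Finsupp.single i 1 : σ →₀ ℕ) j +
              ∑ j ∈ B, (Finsupp.single i 1 : σ →₀ ℕ) j := by
            rw [← Finset.sum_add_distrib]
            refine Finset.sum_congr rfl fun j _ => ?_
            rw [← Finsupp.add_apply, tsub_add_cancel_of_le hle]
          rw [h1] at h2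
          simp only [Set.mem_ofPred_eq]
          omega
        · simp [X, monomial_mul, tsub_add_cancel_of_le hle]
  rw [hspan, mem_ideal_span_monomial_image]
  refine forall₂_congr fun m _ => ⟨?_, fun h => ⟨m, h, le_rfl⟩⟩
  rintro ⟨m', hm', hle⟩
  exact le_trans hm' (Finset.sum_le_sum fun i _ => hle i)

end Generator

section KeyStep

variable {σ k : Type*} [Field k]

theorem degree_filter_mem [Fintype σ] [DecidableEq σ] (B : Finset σ) (m : σ →₀ ℕ) :
    (m.filter (· ∈ B)).degree = ∑ i ∈ B, m i := by
  simp [Finsupp.degree_eq_sum, Finsupp.filter_apply, Finset.sum_ite_mem]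

theorem monomial_mem_span_X_pow {B : Finset σ} {c : ℕ} {m : σ →₀ ℕ} (hm : c ≤ ∑ i ∈ B, m i)
    (a : k) : monomial m a ∈ Ideal.span (X '' (B : Set σ)) ^ c := by
  classical
  rw [mem_span_X_pow_iff]
  intro m' hm'
  rwa [Finset.mem_singleton.1 (support_monomial_subset hm')]

theorem mem_span_X_pow_succ [Fintype σ] {B : Finset σ} {A G : Ideal (MvPolynomial σ k)}
    {M d c : ℕ} (hM : Ideal.span (X '' (B : Set σ)) ^ (M + 1) ≤ A)
    (hstep : ∀ t : MvPolynomial σ k, t.IsHomogeneous c →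
      (∀ q ∈ Ideal.span (X '' (B : Set σ) : Set (MvPolynomial σ k)) ^ (M - c), t * q ∈ A) → t ∈ A)
    {v : MvPolynomial σ k} (hv : ∀ h, h * v ∈ A → h ∈ G ⊔ Ideal.span (X '' (B : Set σ)))
    (hgen : ∀ t ∈ Ideal.span (X '' (B : Set σ) : Set (MvPolynomial σ k)) ^ M,
      t.IsHomogeneous M → ∃ a : k, t - C a * v ∈ A)
    (hlow : ∀ e < d, ∀ h : MvPolynomial σ k, h.IsHomogeneous e →
      h ∈ G ⊔ Ideal.span (X '' (B : Set σ)) → h ∈ Ideal.span (X '' (B : Set σ)))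
    (hAlow : ∀ e < d, ∀ h : MvPolynomial σ k, h.IsHomogeneous e → h ∈ A → h = 0)
    (hc1 : 1 ≤ c) (hcd : c < d) (hcM : c ≤ M) {f : MvPolynomial σ k} (hf : f.IsHomogeneous d)
    (hfA : f ∈ A) (hfc : f ∈ Ideal.span (X '' (B : Set σ)) ^ c) :
    f ∈ Ideal.span (X '' (B : Set σ)) ^ (c + 1) := by
  classical
  set P := Ideal.span (X '' (B : Set σ) : Set (MvPolynomial σ k)) with hP
  have hfc' := mem_span_X_pow_iff.1 hfc
  let S := {m ∈ f.support | ∑ i ∈ B, m i = c}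
  let mx : (σ →₀ ℕ) → (σ →₀ ℕ) := fun m => m.filter (· ∉ B)
  let my : (σ →₀ ℕ) → (σ →₀ ℕ) := fun m => m.filter (· ∈ B)
  have hxy (m) : mx m + my m = m := by
    rw [add_comm]
    exact Finsupp.filter_add_filter_not m (· ∈ B)
  let t : (σ →₀ ℕ) → MvPolynomial σ k := fun β =>
    ∑ m ∈ S with mx m = β, monomial (my m) (coeff m f)
  let T := S.image mx
  have hS (m) (hm : m ∈ S) : m ∈ f.support ∧ ∑ i ∈ B, m i = c := Finset.mem_filter.1 hm
  have hmy (m) (hm : m ∈ S) : (my m).degree = c := by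
    rw [← (hS m hm).2]
    exact degree_filter_mem B m
  have hsum : ∑ β ∈ T, monomial β 1 * t β = ∑ m ∈ S, monomial m (coeff m f) := by
    rw [← Finset.sum_fiberwise_of_maps_to (t := T) (g := mx)
      (fun m hm => Finset.mem_image_of_mem _ hm)]
    refine Finset.sum_congr rfl fun β _ => ?_
    rw [Finset.mul_sum]
    refine Finset.sum_congr rfl fun m hm => ?_
    rw [monomial_mul, one_mul, ← (Finset.mem_filter.1 hm).2, hxy]
  have hdiff : f - ∑ β ∈ T, monomial β 1 * t β ∈ P ^ (c + 1) := by
    rw [hsum, hP, mem_span_X_pow_iff]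
    intro m hm
    rw [mem_support_iff, coeff_sub, coeff_sum] at hm
    simp only [coeff_monomial, Finset.sum_ite_eq'] at hm
    by_cases hmf : m ∈ f.support
    · have h1 := hfc' m hmf
      rcases h1.eq_or_lt with h2 | h2
      · rw [if_pos (Finset.mem_filter.2 ⟨hmf, h2.symm⟩), sub_self] at hm
        exact absurd rfl hm
      · exact h2
    · rw [if_neg fun h => hmf (hS m h).1, sub_zero] at hm
      exact absurd (mem_support_iff.2 hm) hmf
  have htP (β) : t β ∈ P ^ c := by
    refine sum_mem fun m hm => monomial_mem_span_X_pow ?_ _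
    have hmS := (Finset.mem_filter.1 hm).1
    rw [← (hS m hmS).2]
    refine (Finset.sum_congr rfl fun i hi => ?_).le
    exact (Finsupp.filter_apply_pos (· ∈ B) m hi).symm
  have hth (β) : (t β).IsHomogeneous c := by
    refine IsHomogeneous.sum _ _ _ fun m hm => isHomogeneous_monomial _ ?_
    exact hmy m (Finset.mem_filter.1 hm).1
  have ht0 : ∀ β ∈ T, t β = 0 := by
    have hq : ∀ q ∈ P ^ (M - c), q.IsHomogeneous (M - c) → ∀ β ∈ T, t β * q ∈ A := by
      intro q hqP hq
      have h1 (β) : ∃ a : k, t β * q - C a * v ∈ A := by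
        refine hgen _ ?_ ?_
        · rw [← Nat.add_sub_cancel' hcM, pow_add]
          exact Ideal.mul_mem_mul (htP β) hqP
        · have := (hth β).mul hq
          rwa [Nat.add_sub_cancel' hcM] at this
      choose a ha using h1
      have h2 : (∑ β ∈ T, monomial β (a β)) * v ∈ A := by
        have h3 : q * (f - ∑ β ∈ T, monomial β 1 * t β) ∈ A := by
          refine hM ?_
          have : M + 1 = (M - c) + (c + 1) := by omega
          rw [this, pow_add]
          exact Ideal.mul_mem_mul hqP hdiff
        have h4 : (∑ β ∈ T, monomial β (a β)) * v = q * f -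
            q * (f - ∑ β ∈ T, monomial β 1 * t β) -
              ∑ β ∈ T, monomial β 1 * (t β * q - C (a β) * v) := by
          have h5 (β) : monomial β (a β) * v = monomial β 1 * (C (a β) * v) := by
            rw [← mul_assoc, mul_comm (monomial β 1), C_mul_monomial, mul_one]
          simp only [mul_sub, Finset.sum_sub_distrib, Finset.sum_mul, h5, Finset.mul_sum]
          have h6 (β) : monomial β 1 * (t β * q) = q * (monomial β 1 * t β) := by ring
          simp only [h6]
          ring
        rw [h4]
        exact sub_mem (sub_mem (Ideal.mul_mem_left _ _ hfA) h3)
          (sum_mem fun β _ => Ideal.mul_mem_left _ _ (ha β))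
      have h3 : ∑ β ∈ T, monomial β (a β) ∈ P := by
        refine hlow (d - c) (by omega) _ ?_ (hv _ h2)
        refine IsHomogeneous.sum _ _ _ fun β hβ => isHomogeneous_monomial _ ?_
        obtain ⟨m, hm, rfl⟩ := Finset.mem_image.1 hβ
        have h4 : (mx m).degree + (my m).degree = d := by
          rw [← map_add, hxy]
          exact (hf.degree_eq_sum_deg_support (hS m hm).1).symm
        have := hmy m hm
        omega
      intro β hβ
      have h4 : a β = 0 := by
        by_contra h5
        have h6 : β ∈ (∑ β ∈ T, monomial β (a β)).support := by
          rw [mem_support_iff, coeff_sum]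
          simp only [coeff_monomial, Finset.sum_ite_eq', if_pos hβ]
          exact h5
        obtain ⟨i, hi, h7⟩ := mem_ideal_span_X_image.1 h3 β h6
        obtain ⟨m, hm, rfl⟩ := Finset.mem_image.1 hβ
        exact h7 (Finsupp.filter_apply_neg (· ∉ B) m (not_not.2 hi))
      have h5 := ha β
      rwa [h4, C_0, zero_mul, sub_zero] at h5
    intro β hβ
    refine hAlow c hcd _ (hth β) (hstep _ (hth β) fun q hqP => ?_)
    have hqs := span_X_pow_le_span (M - c) hqP
    clear hqP
    induction hqs using Submodule.span_induction with
    | mem q h => exact hq q h.2 h.1 β hβ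
    | zero => simp
    | add x y _ _ hx hy => rw [mul_add]; exact add_mem hx hy
    | smul r x _ hx => rw [smul_eq_mul, mul_left_comm]; exact Ideal.mul_mem_left _ _ hx
  rwa [Finset.sum_eq_zero fun β hβ => by rw [ht0 β hβ, mul_zero], sub_zero] at hdiff

end KeyStep

section Main

variable {σ k : Type*} [Field k]

theorem homogeneousComponent_eq_zero_of_mem_span {s : Set (MvPolynomial σ k)} {d e : ℕ}
    (hs : ∀ a ∈ s, a.IsHomogeneous d) (he : e < d) {f : MvPolynomial σ k}
    (hf : f ∈ Ideal.span s) : homogeneousComponent e f = 0 := by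
  have key : ∀ r, homogeneousComponent e (f * r) = 0 := by
    induction hf using Submodule.span_induction with
    | mem x hx => exact fun r => homogeneousComponent_mul_of_lt (hs x hx) r he
    | zero => simp
    | add x y _ _ hx hy =>
      intro r
      rw [add_mul, map_add, hx, hy, add_zero]
    | smul a x _ hx =>
      intro r
      rw [smul_eq_mul, mul_comm a, mul_assoc]
      exact hx _
  simpa using key 1

theorem IsHomogeneous.mem_span_range_X {f : MvPolynomial σ k} {d : ℕ} (hd : 0 < d)
    (hf : f.IsHomogeneous d) : f ∈ Ideal.span (Set.range (X : σ → MvPolynomial σ k)) := by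
  have h : coeff 0 f = 0 := hf.coeff_eq_zero (by simpa using hd.ne)
  simpa [h] using sub_C_coeff_zero_mem f

theorem vars_subset_of_mem_span_X_pow [Fintype σ] {B : Finset σ} {f : MvPolynomial σ k} {d : ℕ}
    (hf : f.IsHomogeneous d) (h : f ∈ Ideal.span (X '' (B : Set σ)) ^ d) : f.vars ⊆ B := by
  classical
  intro i hi
  obtain ⟨m, hm, him⟩ := (mem_vars_iff_mem_support i).1 hi
  by_contra hiB
  have h1 := mem_span_X_pow_iff.1 h m hm
  have h2 : m.degree = d := (hf.degree_eq_sum_deg_support hm).symm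
  rw [Finsupp.degree_eq_sum, ← Finset.sum_add_sum_compl B] at h2
  have h3 : m i ≤ ∑ j ∈ Bᶜ, m j :=
    Finset.single_le_sum (fun j _ => Nat.zero_le (m j)) (Finset.mem_compl.2 hiB)
  have h4 := Finsupp.mem_support_iff.1 him
  omega

theorem ofList_map_eq_span_image {τ R : Type*} [CommRing R] (B : Finset τ) (f : τ → R) :
    Ideal.ofList (B.toList.map f) = Ideal.span (f '' (B : Set τ)) := by
  rw [Ideal.ofList]
  congr 1
  ext
  simp

/-- If `g` is a regular sequence of forms of degree `d` whose members indexed by `B` lie in the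
ideal of the variables indexed by `B`, and a suitable power of that ideal lies in `(g)`, then those
members involve only the variables indexed by `B`. -/
theorem vars_subset_of_isRegOn [Fintype σ] [DecidableEq σ] {B : Finset σ} {d : ℕ} (hd : 0 < d)
    {g : σ → MvPolynomial σ k} (hhom : ∀ i, (g i).IsHomogeneous d)
    (hreg : IsRegOn ⊥ (Bᶜ.toList.map g ++ B.toList.map g))
    (hmem : ∀ i ∈ B, g i ∈ Ideal.span (X '' (B : Set σ) : Set (MvPolynomial σ k)))
    (hpow : Ideal.span (X '' (B : Set σ)) ^ (B.card * (d - 1) + 1) ≤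
      Ideal.ofList (Bᶜ.toList.map g ++ B.toList.map g)) {i : σ} (hi : i ∈ B) :
    (g i).vars ⊆ B := by
  set P := Ideal.span (X '' (B : Set σ) : Set (MvPolynomial σ k)) with hP
  set A := Ideal.ofList (Bᶜ.toList.map g ++ B.toList.map g) with hA
  set G := Ideal.ofList (Bᶜ.toList.map g) with hG
  have hPX : Ideal.ofList (B.toList.map X) = P := ofList_map_eq_span_image B X
  have hAG : A = G ⊔ Ideal.ofList (B.toList.map g) := Ideal.ofList_append _ _
  let L := Bᶜ.toList ++ B.toList
  have hLmap (f : σ → MvPolynomial σ k) : L.map f = Bᶜ.toList.map f ++ B.toList.map f :=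
    List.map_append
  have hLmem : ∀ j, j ∈ L := fun j => by
    simp only [L, List.mem_append, Finset.mem_toList, Finset.mem_compl]
    exact (em _).symm
  have hLnodup : L.Nodup := by
    rw [List.nodup_append']
    refine ⟨Finset.nodup_toList _, Finset.nodup_toList _, fun j hj hj' => ?_⟩
    rw [Finset.mem_toList] at hj hj'
    exact Finset.mem_compl.1 hj hj'
  have hmapX (l : List σ) (hl : l.Nodup) (s : Set (MvPolynomial σ k))
      (hs : ∀ j ∈ l, ∀ p ∈ s, j ∉ p.vars) : IsRegOn (Ideal.span s) (l.map X) := by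
    simpa using isRegOn_map_X_pow (k := k) (fun _ => 1) hl hs
  have hAhom : IsHomogeneousIdeal A := isHomogeneousIdeal_ofList fun a ha => by
    rw [← hLmap] at ha
    obtain ⟨j, -, rfl⟩ := List.mem_map.1 ha
    exact ⟨d, hhom j⟩
  have hposg (l : List σ) : ∀ a ∈ l.map g, ∃ p, 0 < p ∧ a.IsHomogeneous p := fun a ha => by
    obtain ⟨j, -, rfl⟩ := List.mem_map.1 ha
    exact ⟨d, hd, hhom j⟩
  have hposX (l : List σ) : ∀ a ∈ l.map (X : σ → MvPolynomial σ k),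
      ∃ p, 0 < p ∧ a.IsHomogeneous p := fun a ha => by
    obtain ⟨j, -, rfl⟩ := List.mem_map.1 ha
    exact ⟨1, one_pos, isHomogeneous_X _ j⟩
  set M := B.card * (d - 1) with hM
  set τ := Bᶜ.card * (d - 1) with hτ
  have hs : ∑ _j : σ, (d - 1) = M + τ := by
    rw [← Finset.sum_add_sum_compl B]
    simp [hM, hτ]
  have hregL : IsRegOn ⊥ (L.map g) := by rwa [hLmap]
  have htop : ∀ e, M + τ < e → ∀ h : MvPolynomial σ k, h.IsHomogeneous e → h ∈ A := by
    intro e he h hh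
    have := mem_ofList_of_sum_lt hLnodup hLmem hhom hregL (by rwa [hs]) hh
    rwa [hLmap] at this
  have hz : ∃ z : MvPolynomial σ k, z.IsHomogeneous (M + τ) ∧ z ∉ A := by
    have := exists_notMem_ofList hLnodup (fun _ => hd) hhom hregL
    rwa [hs, hLmap] at this
  have hpair : ∀ (t : MvPolynomial σ k) (c : ℕ), t.IsHomogeneous c → t ∉ A →
      ∃ e r, c + e = M + τ ∧ IsHomogeneous r e ∧ t * r ∉ A := by
    have hm : Ideal.ofList (L.map X) = Ideal.span (Set.range (X : σ → MvPolynomial σ k)) := by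
      rw [Ideal.ofList]
      congr 1
      ext
      simp [hLmem]
    obtain ⟨w, hw, -⟩ := exists_colon_generator (⊥ : Ideal (MvPolynomial σ k))
      (a := L.map g) (c := L.map X) (by simp)
      (by
        intro x hx
        obtain ⟨j, -, rfl⟩ := List.mem_map.1 hx
        rw [hm]
        exact IsHomogeneous.mem_span_range_X hd (hhom j))
      hregL (by rw [← Ideal.span_empty]; exact hmapX L hLnodup ∅ (by simp))
    rw [hm, bot_sup_eq, hLmap] at hw
    exact fun t c ht htA => exists_mul_notMem_of_socle hAhom hw htop hz ht htA
  have hregX : IsRegOn ⊥ (Bᶜ.toList.map g ++ B.toList.map X) := by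
    refine IsRegOn.append_of_mem_ofList (by simp) ?_ (hposX _) (hposg _) (hposg _)
      isHomogeneousIdeal_bot ?_ hreg
    · intro y hy
      obtain ⟨j, hj, rfl⟩ := List.mem_map.1 hy
      rw [hPX]
      exact hmem j (Finset.mem_toList.1 hj)
    · rw [← Ideal.span_empty]
      exact hmapX _ (Finset.nodup_toList _) ∅ (by simp)
  obtain ⟨u, hu, hu'⟩ := exists_colon_generator G (a := B.toList.map g) (c := B.toList.map X)
    (by simp)
    (by
      intro y hy
      obtain ⟨j, hj, rfl⟩ := List.mem_map.1 hy
      rw [hPX]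
      exact hmem j (Finset.mem_toList.1 hj))
    (by simpa using ((isRegOn_append _ _ _).1 hreg).2)
    (by simpa using ((isRegOn_append _ _ _).1 hregX).2)
  rw [← hAG, hPX] at hu hu'
  have hτG : ∀ e, τ < e → ∀ h : MvPolynomial σ k, h.IsHomogeneous e → h ∈ G ⊔ P := by
    intro e he h hh
    let f : σ → MvPolynomial σ k := fun j => if j ∈ B then X j else g j
    let p : σ → ℕ := fun j => if j ∈ B then 1 else d
    have hf : L.map f = Bᶜ.toList.map g ++ B.toList.map X := by
      rw [hLmap]
      congr 1 <;> refine List.map_congr_left fun j hj => ?_ <;> rw [Finset.mem_toList] at hj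
      · exact if_neg (Finset.mem_compl.1 hj)
      · exact if_pos hj
    have hp : ∑ j, (p j - 1) = τ := by
      rw [← Finset.sum_add_sum_compl B, Finset.sum_eq_zero, zero_add, hτ,
        Finset.sum_congr rfl (g := fun _ => d - 1)]
      · simp
      · intro j hj
        simp only [p, if_neg (Finset.mem_compl.1 hj)]
      · intro j hj
        simp only [p, if_pos hj, Nat.sub_self]
    have hfp : ∀ j, (f j).IsHomogeneous (p j) := by
      intro j
      by_cases hj : j ∈ B
      · simpa only [f, p, if_pos hj] using isHomogeneous_X k j
      · simpa only [f, p, if_neg hj] using hhom j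
    have := mem_ofList_of_sum_lt hLnodup hLmem hfp (by rwa [hf]) (by rwa [hp]) hh
    rwa [hf, Ideal.ofList_append, hPX] at this
  have hGA : G ≤ A := hAG ▸ le_sup_left
  have hτA : ∀ e, τ < e → ∀ h : MvPolynomial σ k, h.IsHomogeneous e → h ∈ A ⊔ P :=
    fun e he h hh => sup_le_sup_right hGA P (hτG e he h hh)
  obtain ⟨v, -, hv, hgen⟩ := exists_generator_homogeneous hAhom hGA hτG hz hpow
    (fun h => (hu h).1) hu'
  have hzero (l : List σ) : ∀ e < d, ∀ h ∈ Ideal.ofList (l.map g),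
      homogeneousComponent e h = 0 := fun e he h hh =>
    homogeneousComponent_eq_zero_of_mem_span (fun a ha => by
      obtain ⟨j, -, rfl⟩ := List.mem_map.1 ha
      exact hhom j) he hh
  have hlow : ∀ e < d, ∀ h : MvPolynomial σ k, h.IsHomogeneous e → h ∈ G ⊔ P → h ∈ P := by
    intro e he h hh hGP
    obtain ⟨x, hx, y, hy, hxy⟩ := Submodule.mem_sup.1 hGP
    rw [← homogeneousComponent_eq_self hh, ← hxy, map_add, hzero _ e he x hx, zero_add]
    refine isHomogeneousIdeal_span ?_ y hy e
    rintro _ ⟨j, -, rfl⟩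
    exact ⟨1, isHomogeneous_X _ j⟩
  have hAlow : ∀ e < d, ∀ h : MvPolynomial σ k, h.IsHomogeneous e → h ∈ A → h = 0 := by
    intro e he h hh hhA
    rw [← homogeneousComponent_eq_self hh]
    exact hzero L e he h (by rwa [hLmap])
  have hgA : g i ∈ A := Ideal.subset_span (by
    show g i ∈ Bᶜ.toList.map g ++ B.toList.map g
    rw [← hLmap]
    exact List.mem_map_of_mem (hLmem i))
  have hcard : 1 ≤ B.card := Finset.card_pos.2 ⟨i, hi⟩
  have hind : ∀ c, c + 1 ≤ d → g i ∈ P ^ (c + 1) := by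
    intro c
    induction c with
    | zero => simpa using fun _ => hmem i hi
    | succ c ih =>
      intro hc
      have hcM : c + 1 ≤ M := by
        have : 1 * (d - 1) ≤ M := Nat.mul_le_mul_right _ hcard
        omega
      exact mem_span_X_pow_succ hpow
        (fun t ht hq => mem_of_mul_pow_mem hAhom hτA hpair ht (Nat.add_sub_cancel' hcM) hq)
        hv hgen hlow hAlow (by omega) (by omega) hcM (hhom i) hgA (ih (by omega))
  refine vars_subset_of_mem_span_X_pow (hhom i) ?_
  obtain ⟨c, rfl⟩ := Nat.exists_eq_add_of_le' hd
  exact hind c le_rfl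

theorem span_X_pow_le_of_isRegOn [Fintype σ] [DecidableEq σ] {B : Finset σ} {d : ℕ}
    {g : σ → MvPolynomial σ k} (hhom : ∀ i, (g i).IsHomogeneous d)
    (hreg : IsRegOn ⊥ (B.toList.map g)) (hvars : ∀ i ∈ B, (g i).vars ⊆ B) :
    Ideal.span (X '' (B : Set σ)) ^ (B.card * (d - 1) + 1) ≤ Ideal.ofList (B.toList.map g) := by
  let L := B.toList ++ Bᶜ.toList
  have hLmem : ∀ j, j ∈ L := fun j => by
    simp only [L, List.mem_append, Finset.mem_toList, Finset.mem_compl]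
    exact em _
  have hLnodup : L.Nodup := by
    rw [List.nodup_append']
    refine ⟨Finset.nodup_toList _, Finset.nodup_toList _, fun j hj hj' => ?_⟩
    rw [Finset.mem_toList] at hj hj'
    exact Finset.mem_compl.1 hj' hj
  let f : σ → MvPolynomial σ k := fun j => if j ∈ B then g j else X j
  let p : σ → ℕ := fun j => if j ∈ B then d else 1
  have hf : L.map f = B.toList.map g ++ Bᶜ.toList.map X := by
    rw [List.map_append]
    congr 1 <;> refine List.map_congr_left fun j hj => ?_ <;> rw [Finset.mem_toList] at hj
    · exact if_pos hj
    · exact if_neg (Finset.mem_compl.1 hj)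
  have hp : ∑ j, (p j - 1) = B.card * (d - 1) := by
    rw [← Finset.sum_add_sum_compl B, Finset.sum_eq_zero (s := Bᶜ), add_zero,
      Finset.sum_congr rfl (g := fun _ => d - 1)]
    · simp
    · intro j hj
      simp only [p, if_pos hj]
    · intro j hj
      simp only [p, if_neg (Finset.mem_compl.1 hj), Nat.sub_self]
  have hfp : ∀ j, (f j).IsHomogeneous (p j) := by
    intro j
    by_cases hj : j ∈ B
    · simpa only [f, p, if_pos hj] using hhom j
    · simpa only [f, p, if_neg hj] using isHomogeneous_X k j
  have hregL : IsRegOn ⊥ (L.map f) := by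
    rw [hf, isRegOn_append, bot_sup_eq]
    refine ⟨hreg, ?_⟩
    have := isRegOn_map_X_pow (k := k) (fun _ => 1) (Finset.nodup_toList Bᶜ)
      (s := {a | a ∈ B.toList.map g}) (by
        intro j hj a ha hja
        obtain ⟨i, hi, rfl⟩ := List.mem_map.1 ha
        exact Finset.mem_compl.1 (Finset.mem_toList.1 hj)
          (hvars i (Finset.mem_toList.1 hi) hja))
    simp only [pow_one] at this
    exact this
  refine (span_X_pow_le_span _).trans (Ideal.span_le.2 ?_)
  rintro t ⟨ht, htP⟩
  have h1 := mem_ofList_of_sum_lt hLnodup hLmem hfp hregL (by rw [hp]; exact Nat.lt_succ_self _) ht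
  rw [hf, Ideal.ofList_append] at h1
  let ρ : MvPolynomial σ k →ₐ[k] MvPolynomial σ k := aeval fun j => if j ∈ B then X j else 0
  have hρ (q : MvPolynomial σ k) (hq : q.vars ⊆ B) : ρ q = q := by
    conv_rhs => rw [← aeval_X_left_apply q]
    refine eval₂Hom_congr' rfl (fun j hj _ => ?_) rfl
    exact if_pos (hq hj)
  obtain ⟨x, hx, y, hy, hxy⟩ := Submodule.mem_sup.1 h1
  have hρy : ρ y = 0 := by
    have : Ideal.ofList (Bᶜ.toList.map X) ≤ RingHom.ker ρ := by
      refine Ideal.span_le.2 ?_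
      intro a ha
      obtain ⟨j, hj, rfl⟩ := List.mem_map.1 ha
      have hj := Finset.mem_compl.1 (Finset.mem_toList.1 hj)
      simp [ρ, RingHom.mem_ker, hj]
    exact this hy
  have hρx : ρ x ∈ Ideal.ofList (B.toList.map g) := by
    have : Ideal.ofList (B.toList.map g) ≤ (Ideal.ofList (B.toList.map g)).comap ρ := by
      refine Ideal.span_le.2 ?_
      intro a ha
      have ha' := ha
      obtain ⟨j, hj, rfl⟩ := List.mem_map.1 ha'
      rw [SetLike.mem_coe, Ideal.mem_comap, hρ _ (hvars j (Finset.mem_toList.1 hj))]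
      exact Ideal.subset_span ha
    exact this hx
  rw [← hρ t (vars_subset_of_mem_span_X_pow ht htP), ← hxy, map_add, hρy, add_zero]
  exact hρx

theorem degree_pos_of_isRegular {l : List (MvPolynomial σ k)} {d : ℕ} (hl : l ≠ [])
    (hhom : ∀ a ∈ l, a.IsHomogeneous d)
    (hreg : RingTheory.Sequence.IsRegular (MvPolynomial σ k) l) : 0 < d := by
  rw [pos_iff_ne_zero]
  rintro rfl
  obtain ⟨a, l, rfl⟩ := List.exists_cons_of_ne_nil hl
  have ha : a = C (coeff 0 a) := by
    rw [← homogeneousComponent_zero, homogeneousComponent_eq_self (hhom a List.mem_cons_self)]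
  have hreg' := (isRegOn_of_isWeaklyRegular hreg.toIsWeaklyRegular).1 1
  by_cases h0 : coeff 0 a = 0
  · rw [h0, map_zero] at ha
    exact one_ne_zero (hreg' (by simp [ha]))
  · refine hreg.top_ne_smul ?_
    have : Ideal.ofList (a :: l) = ⊤ := by
      refine Ideal.eq_top_of_isUnit_mem _ (Ideal.subset_span List.mem_cons_self) ?_
      rw [ha]
      exact (IsUnit.mk0 _ h0).map C
    rw [this, Submodule.top_smul]

end Main

/-- Lemma 3.4: if `g_1,…,g_n` is a regular sequence of degree-`d` forms with
`g_{b+1},…,g_n ∈ (x_{b+1},…,x_n)` and `(x_{b+1},…,x_n)^{(n-b)(d-1)+1} ⊆ (g_1,…,g_n)`,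
then `(x_{b+1},…,x_n)^{(n-b)(d-1)+1} ⊆ (g_{b+1},…,g_n)`. -/
theorem stmt7 {k : Type*} [Field k] {n d b : ℕ} (hb1 : 1 ≤ b) (hb2 : b ≤ n - 1)
    (g : Fin n → MvPolynomial (Fin n) k)
    (hhom : ∀ i, (g i).IsHomogeneous d)
    (hreg : RingTheory.Sequence.IsRegular (MvPolynomial (Fin n) k) (List.ofFn g))
    (hmem : ∀ i : Fin n, b ≤ (i : ℕ) →
      g i ∈ Ideal.span {p : MvPolynomial (Fin n) k | ∃ j : Fin n, b ≤ (j : ℕ) ∧ p = X j})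
    (hpow : (Ideal.span {p : MvPolynomial (Fin n) k | ∃ j : Fin n, b ≤ (j : ℕ) ∧ p = X j}) ^
        ((n - b) * (d - 1) + 1) ≤ Ideal.span (Set.range g)) :
    (Ideal.span {p : MvPolynomial (Fin n) k | ∃ j : Fin n, b ≤ (j : ℕ) ∧ p = X j}) ^
        ((n - b) * (d - 1) + 1) ≤
      Ideal.span {p : MvPolynomial (Fin n) k | ∃ i : Fin n, b ≤ (i : ℕ) ∧ p = g i} := by
  let B : Finset (Fin n) := {i | b ≤ (i : ℕ)}
  have hB (i : Fin n) : i ∈ B ↔ b ≤ (i : ℕ) := by simp [B]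
  have himage (f : Fin n → MvPolynomial (Fin n) k) :
      {p | ∃ j : Fin n, b ≤ (j : ℕ) ∧ p = f j} = f '' (B : Set (Fin n)) := by
    ext
    simp [B, eq_comm]
  have hcard : B.card = n - b := by
    have h1 : B.map Fin.valEmbedding = Finset.Ico b n := by
      ext j
      simp only [Finset.mem_map, Fin.valEmbedding_apply, Finset.mem_Ico, hB]
      exact ⟨by rintro ⟨i, hi, rfl⟩; exact ⟨hi, i.2⟩, fun h => ⟨⟨j, h.2⟩, h.1, rfl⟩⟩
    rw [← Finset.card_map Fin.valEmbedding, h1, Nat.card_Ico]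
  have hperm : (Bᶜ.toList.map g ++ B.toList.map g).Perm (List.ofFn g) := by
    rw [List.ofFn_eq_map, ← List.map_append]
    refine List.Perm.map g ((List.perm_ext_iff_of_nodup ?_ (List.nodup_finRange n)).2 ?_)
    · rw [List.nodup_append']
      refine ⟨Finset.nodup_toList _, Finset.nodup_toList _, fun j hj hj' => ?_⟩
      rw [Finset.mem_toList] at hj hj'
      exact Finset.mem_compl.1 hj hj'
    · intro j
      simp only [List.mem_append, Finset.mem_toList, Finset.mem_compl, List.mem_finRange, iff_true]
      exact (em _).symm
  have hreg' := isRegOn_of_isWeaklyRegular hreg.toIsWeaklyRegular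
  have hd : 0 < d := by
    refine degree_pos_of_isRegular (fun h => ?_) (fun a ha => ?_) hreg
    · rw [List.ofFn_eq_nil_iff] at h
      omega
    · obtain ⟨i, rfl⟩ := (List.mem_ofFn' _ _).1 ha
      exact hhom i
  have hpos : ∀ a ∈ List.ofFn g, ∃ p, 0 < p ∧ a.IsHomogeneous p := by
    intro a ha
    obtain ⟨i, rfl⟩ := (List.mem_ofFn' _ _).1 ha
    exact ⟨d, hd, hhom i⟩
  have hregB : IsRegOn ⊥ (Bᶜ.toList.map g ++ B.toList.map g) :=
    hreg'.perm hperm.symm isHomogeneousIdeal_bot hpos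
  have hregB' : IsRegOn ⊥ (B.toList.map g ++ Bᶜ.toList.map g) :=
    hreg'.perm (hperm.symm.trans List.perm_append_comm) isHomogeneousIdeal_bot hpos
  have hA : Ideal.span (Set.range g) = Ideal.ofList (Bᶜ.toList.map g ++ B.toList.map g) := by
    rw [Ideal.ofList]
    congr 1
    ext a
    simp only [Set.mem_range, Set.mem_ofPred_eq, hperm.mem_iff, List.mem_ofFn']
  rw [himage X, himage g, ← hcard, ← ofList_map_eq_span_image B g]
  rw [himage X, hA, ← hcard] at hpow
  refine span_X_pow_le_of_isRegOn hhom ((isRegOn_append _ _ _).1 hregB').1 fun i hi => ?_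
  refine vars_subset_of_isRegOn hd hhom hregB (fun i hi => ?_) hpow hi
  rw [← himage]
  exact hmem i ((hB i).1 hi)
end

section
/- Let 1 ≤ b ≤ n−1 and suppose g_1,…,g_n ∈ S is a regular sequence of homogeneous forms of degree d such that (g_{b+1},…,g_n) ⊆ (x_{b+1},…,x_n) and (x_{b+1},…,x_n)^{(n−b)(d−1)+1} ⊆ (g_{b+1},…,g_n). Then g_{b+1},…,g_n ∈ k[x_{b+1},…,x_n], i.e., each of g_{b+1},…,g_n is a polynomial in the variables x_{b+1},…,x_n alone. -/
open MvPolynomial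

namespace Ideal

section Regular

variable {A : Type*} [CommRing A]

/-- Multiplication by `a` is injective modulo `I`. -/
def IsRegularElemMod (I : Ideal A) (a : A) : Prop :=
  ∀ x, a * x ∈ I → x ∈ I

/-- The list `l` is a weakly regular sequence modulo `I`. -/
def IsRegularSeqMod (I : Ideal A) : List A → Prop
  | [] => True
  | a :: l => I.IsRegularElemMod a ∧ IsRegularSeqMod (I ⊔ span {a}) l

theorem IsRegularSeqMod.of_forall_take {l : List A} {I : Ideal A}
    (h : ∀ (i : ℕ) (hi : i < l.length), (I ⊔ ofList (l.take i)).IsRegularElemMod l[i]) :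
    I.IsRegularSeqMod l := by
  induction l generalizing I with
  | nil => trivial
  | cons a l ih =>
    have h₀ := h 0 (by simp)
    rw [List.take_zero, ofList_nil, sup_bot_eq] at h₀
    refine ⟨h₀, ih fun i hi => ?_⟩
    have := h (i + 1) (by simpa using hi)
    simpa [ofList_cons, sup_assoc] using this

theorem isRegularSeqMod_bot_of_isWeaklyRegular {l : List A}
    (h : RingTheory.Sequence.IsWeaklyRegular A l) : (⊥ : Ideal A).IsRegularSeqMod l := by
  refine .of_forall_take fun i hi x hx => ?_
  have := h.regular_mod_prev i hi
  rw [isSMulRegular_iff_right_eq_zero_of_smul] at this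
  rw [bot_sup_eq] at hx ⊢
  have hx' := this (Submodule.Quotient.mk x) (by
    rw [← Submodule.Quotient.mk_smul, Submodule.Quotient.mk_eq_zero]
    simpa using hx)
  rw [Submodule.Quotient.mk_eq_zero] at hx'
  simpa using hx'

theorem isRegularElemMod_iff_forall_associatedPrimes [IsNoetherianRing A] {I : Ideal A} {a : A} :
    I.IsRegularElemMod a ↔ ∀ Q ∈ associatedPrimes A (A ⧸ I), a ∉ Q := by
  have h := Set.ext_iff.1 (biUnion_associatedPrimes_eq_zero_divisors A (A ⧸ I)) a
  simp only [Set.mem_iUnion, SetLike.mem_coe, exists_prop, Set.mem_ofPred_eq] at h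
  have key : I.IsRegularElemMod a ↔ ¬ ∃ x : A ⧸ I, x ≠ 0 ∧ a • x = 0 := by
    constructor
    · rintro h ⟨x, hx, hax⟩
      obtain ⟨x, rfl⟩ := Ideal.Quotient.mk_surjective x
      rw [Ne, Ideal.Quotient.eq_zero_iff_mem] at hx
      exact hx (h x (Ideal.Quotient.eq_zero_iff_mem.1 hax))
    · intro h x hx
      by_contra hxI
      exact h ⟨Ideal.Quotient.mk I x, by rwa [Ne, Ideal.Quotient.eq_zero_iff_mem],
        Ideal.Quotient.eq_zero_iff_mem.2 hx⟩
  rw [key, ← h]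
  push Not
  rfl

end Regular

section Graded

variable {A σ : Type*} [CommRing A] [SetLike σ A] [AddSubmonoidClass σ A]
  (𝒜 : ℕ → σ) [GradedRing 𝒜]

open DirectSum

/-- A homogeneous element of positive degree lying in the ideal `P`. -/
def IsPosHomogeneousIn (P : Ideal A) (a : A) : Prop :=
  a ∈ P ∧ ∃ i, 0 < i ∧ a ∈ 𝒜 i

variable {𝒜}

theorem IsHomogeneous.sup_span_singleton {I : Ideal A} (hI : I.IsHomogeneous 𝒜) {a : A} {i : ℕ}
    (ha : a ∈ 𝒜 i) : (I ⊔ span {a}).IsHomogeneous 𝒜 :=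
  hI.sup (homogeneous_span 𝒜 _ (by rintro _ rfl; exact ⟨i, ha⟩))

theorem IsHomogeneous.sup_ofList {I : Ideal A} (hI : I.IsHomogeneous 𝒜) {l : List A}
    (hl : ∀ a ∈ l, ∃ i, a ∈ 𝒜 i) : (I ⊔ ofList l).IsHomogeneous 𝒜 :=
  hI.sup (homogeneous_span 𝒜 _ hl)

theorem IsHomogeneous.exists_of_mem_sup_span_singleton {I : Ideal A} (hI : I.IsHomogeneous 𝒜)
    {a x : A} {i m : ℕ} (ha : a ∈ 𝒜 i) (hx : x ∈ 𝒜 m) (h : x ∈ I ⊔ span {a}) :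
    x ∈ I ∨ ∃ j, ∃ t ∈ 𝒜 j, i + j = m ∧ x - a * t ∈ I := by
  obtain ⟨l, hl, _, ht, rfl⟩ := Submodule.mem_sup.1 h
  obtain ⟨t, rfl⟩ := mem_span_singleton'.1 ht
  rw [mul_comm t a] at *
  have hlm : (decompose 𝒜 l m : A) ∈ I := hI m hl
  have hx' := decompose_of_mem_same 𝒜 hx
  rw [decompose_add, DirectSum.add_apply, AddMemClass.coe_add] at hx'
  by_cases him : i ≤ m
  · rw [coe_decompose_mul_of_left_mem_of_le 𝒜 ha him] at hx'
    refine .inr ⟨m - i, _, SetLike.coe_mem (decompose 𝒜 t (m - i)), by omega, ?_⟩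
    rw [← hx', add_sub_cancel_right]
    exact hlm
  · rw [coe_decompose_mul_of_left_mem_of_not_le 𝒜 ha him, add_zero] at hx'
    exact .inl (hx' ▸ hlm)

theorem IsHomogeneous.mem_of_forall_mem_sup_span_pow {I : Ideal A} (hI : I.IsHomogeneous 𝒜)
    {a x : A} {i : ℕ} (ha : a ∈ 𝒜 i) (hi : 0 < i) (h : ∀ m : ℕ, x ∈ I ⊔ span {a ^ m}) :
    x ∈ I := by
  rw [hI.mem_iff]
  intro j
  obtain ⟨l, hl, _, ht, rfl⟩ := Submodule.mem_sup.1 (h (j + 1))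
  obtain ⟨t, rfl⟩ := mem_span_singleton'.1 ht
  have hpow : a ^ (j + 1) ∈ 𝒜 ((j + 1) • i) := SetLike.pow_mem_graded _ ha
  have hlt : ¬ (j + 1) • i ≤ j := by
    rw [smul_eq_mul]; nlinarith
  rw [mul_comm t, decompose_add, DirectSum.add_apply, AddMemClass.coe_add,
    coe_decompose_mul_of_left_mem_of_not_le 𝒜 hpow hlt, add_zero]
  exact hI j hl

/-- Two consecutive elements of a homogeneous regular sequence may be swapped. -/
theorem IsHomogeneous.isRegularElemMod_swap {I : Ideal A} (hI : I.IsHomogeneous 𝒜)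
    {a b : A} {i : ℕ} (ha : a ∈ 𝒜 i) (hi : 0 < i) (h₁ : I.IsRegularElemMod a)
    (h₂ : (I ⊔ span {a}).IsRegularElemMod b) :
    I.IsRegularElemMod b ∧ (I ⊔ span {b}).IsRegularElemMod a := by
  constructor
  · intro x hx
    refine hI.mem_of_forall_mem_sup_span_pow ha hi fun m => ?_
    induction m generalizing x with
    | zero => simp
    | succ m ih =>
      obtain ⟨l, hl, _, ht, rfl⟩ := Submodule.mem_sup.1 (h₂ x (Submodule.mem_sup_left hx))
      obtain ⟨t, rfl⟩ := mem_span_singleton'.1 ht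
      have hbt : b * t ∈ I := h₁ _ (by
        have := I.sub_mem hx (I.mul_mem_left b hl)
        convert this using 1; ring)
      obtain ⟨l', hl', _, hs, hs'⟩ := Submodule.mem_sup.1 (ih t hbt)
      obtain ⟨s, rfl⟩ := mem_span_singleton'.1 hs
      refine Submodule.mem_sup.2 ⟨l + a * l', I.add_mem hl (I.mul_mem_left _ hl'),
        s * a ^ (m + 1), mem_span_singleton'.2 ⟨s, rfl⟩, ?_⟩
      rw [← hs']; ring
  · intro x hx
    obtain ⟨l, hl, _, ht, h⟩ := Submodule.mem_sup.1 hx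
    obtain ⟨t, rfl⟩ := mem_span_singleton'.1 ht
    have hbt : b * t ∈ I ⊔ span {a} := Submodule.mem_sup.2
      ⟨-l, I.neg_mem hl, x * a, mem_span_singleton'.2 ⟨x, rfl⟩, by linear_combination -h⟩
    obtain ⟨l', hl', _, hs, rfl⟩ := Submodule.mem_sup.1 (h₂ t hbt)
    obtain ⟨s, rfl⟩ := mem_span_singleton'.1 hs
    have hxs : x - b * s ∈ I := h₁ _ (by
      have := I.add_mem hl (I.mul_mem_left b hl')
      convert this using 1; linear_combination -h)
    exact Submodule.mem_sup.2 ⟨_, hxs, s * b, mem_span_singleton'.2 ⟨s, rfl⟩, by ring⟩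

theorem IsHomogeneous.isRegularSeqMod_tail {I : Ideal A} (hI : I.IsHomogeneous 𝒜)
    {a : A} {l : List A} (hl : ∀ x ∈ a :: l, ∃ i, 0 < i ∧ x ∈ 𝒜 i)
    (h : I.IsRegularSeqMod (a :: l)) :
    I.IsRegularSeqMod l ∧ (I ⊔ ofList l).IsRegularElemMod a := by
  induction l generalizing I with
  | nil => exact ⟨trivial, by simpa using h.1⟩
  | cons b l ih =>
    obtain ⟨i, hi, ha⟩ := hl a (by simp)
    obtain ⟨j, hj, hb⟩ := hl b (by simp)
    obtain ⟨h₁, h₂, h₃⟩ := h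
    obtain ⟨hb', ha'⟩ := hI.isRegularElemMod_swap ha hi h₁ h₂
    rw [sup_right_comm] at h₃
    have := ih (hI.sup_span_singleton hb) (fun x hx => hl x (by
      simp only [List.mem_cons] at hx ⊢; tauto)) ⟨ha', h₃⟩
    exact ⟨⟨hb', this.1⟩, by rw [ofList_cons, ← sup_assoc]; exact this.2⟩

theorem IsHomogeneous.isRegularSeqMod_cons {I : Ideal A} (hI : I.IsHomogeneous 𝒜)
    {a : A} {l : List A} (hl : ∀ x ∈ l, ∃ i, 0 < i ∧ x ∈ 𝒜 i)
    (h : I.IsRegularSeqMod l) (ha : (I ⊔ ofList l).IsRegularElemMod a) :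
    I.IsRegularSeqMod (a :: l) := by
  induction l generalizing I with
  | nil => exact ⟨by simpa using ha, trivial⟩
  | cons b l ih =>
    obtain ⟨j, hj, hb⟩ := hl b (by simp)
    obtain ⟨h₁, h₂⟩ := h
    rw [ofList_cons, ← sup_assoc] at ha
    obtain ⟨ha', h₃⟩ := ih (hI.sup_span_singleton hb) (fun x hx => hl x (by simp [hx])) h₂ ha
    obtain ⟨ha'', hb'⟩ := hI.isRegularElemMod_swap hb hj h₁ ha'
    exact ⟨ha'', hb', by rwa [sup_right_comm]⟩

/-- Homogeneous prime avoidance. -/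
theorem exists_isPosHomogeneousIn_forall_notMem {P : Ideal A} (s : Finset (Ideal A))
    (hprime : ∀ Q ∈ s, Q.IsPrime) (hhom : ∀ Q ∈ s, Q.IsHomogeneous 𝒜) (hne : s.Nonempty)
    (h : ∀ Q ∈ s, ∃ a, P.IsPosHomogeneousIn 𝒜 a ∧ a ∉ Q) :
    ∃ a, P.IsPosHomogeneousIn 𝒜 a ∧ ∀ Q ∈ s, a ∉ Q := by
  classical
  induction s using Finset.strongInduction with
  | H s ih =>
    obtain ⟨Q, hQ⟩ := s.exists_minimal hne
    have hQp := hprime Q hQ.1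
    obtain ⟨v, ⟨hvP, j, hj, hv⟩, hvQ⟩ := h Q hQ.1
    rcases (s.erase Q).eq_empty_or_nonempty with he | he
    · refine ⟨v, ⟨hvP, j, hj, hv⟩, fun Q' hQ' => ?_⟩
      by_cases hQQ : Q' = Q
      · rwa [hQQ]
      · have := Finset.mem_erase.2 ⟨hQQ, hQ'⟩
        simp [he] at this
    obtain ⟨p, ⟨hpP, i, hi, hp⟩, hps⟩ := ih (s.erase Q) (Finset.erase_ssubset hQ.1)
      (fun R hR => hprime R (Finset.mem_of_mem_erase hR))
      (fun R hR => hhom R (Finset.mem_of_mem_erase hR)) he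
      (fun R hR => h R (Finset.mem_of_mem_erase hR))
    by_cases hpQ : p ∈ Q
    swap
    · refine ⟨p, ⟨hpP, i, hi, hp⟩, fun R hR => ?_⟩
      by_cases hRQ : R = Q
      · rwa [hRQ]
      · exact hps R (Finset.mem_erase.2 ⟨hRQ, hR⟩)
    have hx : ∀ R ∈ s.erase Q, ∃ x ∈ R, x ∉ Q ∧ ∃ m, x ∈ 𝒜 m := by
      intro R hR
      obtain ⟨hRQ, hRs⟩ := Finset.mem_erase.1 hR
      have hnle : ¬ R ≤ Q := fun hle => hRQ (le_antisymm hle (hQ.2 hRs hle))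
      obtain ⟨x, hxR, hxQ⟩ := SetLike.not_le_iff_exists.1 hnle
      rw [(hhom Q hQ.1).mem_iff] at hxQ
      push Not at hxQ
      obtain ⟨m, hm⟩ := hxQ
      exact ⟨_, hhom R hRs m hxR, hm, m, SetLike.coe_mem _⟩
    choose! x hxR hxQ m hxm using hx
    have hprod : ∏ R ∈ s.erase Q, x R ∈ 𝒜 (∑ R ∈ s.erase Q, m R) :=
      SetLike.prod_mem_graded 𝒜 m x fun R hR => hxm R hR
    set q := v * ∏ R ∈ s.erase Q, x R with hq
    set n := j + ∑ R ∈ s.erase Q, m R with hn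
    have hqn : q ∈ 𝒜 n := SetLike.mul_mem_graded hv hprod
    have hqP : q ∈ P := P.mul_mem_right _ hvP
    have hqQ : q ∉ Q := by
      intro hmem
      rcases hQp.mem_or_mem hmem with h' | h'
      · exact hvQ h'
      · obtain ⟨R, hR, hRx⟩ := (hQp.prod_mem_iff).1 h'
        exact hxQ R hR hRx
    have hn0 : 0 < n := by omega
    refine ⟨p ^ n + q ^ i, ⟨P.add_mem (P.pow_mem_of_mem hpP n hn0) (P.pow_mem_of_mem hqP i hi),
      n * i, Nat.mul_pos hn0 hi, ?_⟩, fun R hR => ?_⟩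
    · refine add_mem (SetLike.pow_mem_graded n hp) ?_
      have := SetLike.pow_mem_graded i hqn
      rwa [smul_eq_mul, mul_comm] at this
    · by_cases hRQ : R = Q
      · subst hRQ
        rw [R.add_mem_iff_right (R.pow_mem_of_mem hpQ n hn0)]
        exact fun h' => hqQ (hQp.mem_of_pow_mem _ h')
      · have hR' := Finset.mem_erase.2 ⟨hRQ, hR⟩
        have hqR : q ∈ R := R.mul_mem_left _
          (R.mem_of_dvd (Finset.dvd_prod_of_mem x hR') (hxR R hR'))
        rw [R.add_mem_iff_left (R.pow_mem_of_mem hqR i hi)]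
        exact fun h' => hps R hR' ((hprime R hR).mem_of_pow_mem _ h')

theorem exists_isPosHomogeneousIn_isRegularElemMod [IsNoetherianRing A] {P I J : Ideal A}
    {a b : A} (ha : P.IsPosHomogeneousIn 𝒜 a) (hb : P.IsPosHomogeneousIn 𝒜 b)
    (hI : I.IsRegularElemMod a) (hJ : J.IsRegularElemMod b) :
    ∃ p, P.IsPosHomogeneousIn 𝒜 p ∧ I.IsRegularElemMod p ∧ J.IsRegularElemMod p := by
  classical
  rw [isRegularElemMod_iff_forall_associatedPrimes] at hI hJ
  simp only [isRegularElemMod_iff_forall_associatedPrimes]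
  let s : Finset (Ideal A) := (associatedPrimes.finite A (A ⧸ I)).toFinset ∪
    (associatedPrimes.finite A (A ⧸ J)).toFinset
  have hs : ∀ Q, Q ∈ s ↔ Q ∈ associatedPrimes A (A ⧸ I) ∨ Q ∈ associatedPrimes A (A ⧸ J) := by
    simp [s]
  let core : Ideal A → Ideal A := fun Q => (Q.homogeneousCore 𝒜).toIdeal
  have hcore : ∀ Q x, (∃ i, x ∈ 𝒜 i) → (x ∈ core Q ↔ x ∈ Q) := fun Q x hx =>
    ⟨fun h => toIdeal_homogeneousCore_le 𝒜 Q h, mem_homogeneousCore_of_homogeneous_of_mem hx⟩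
  rcases s.eq_empty_or_nonempty with he | hne
  · have : ∀ Q, ¬ (Q ∈ associatedPrimes A (A ⧸ I) ∨ Q ∈ associatedPrimes A (A ⧸ J)) := by
      intro Q; rw [← hs, he]; simp
    exact ⟨a, ha, fun Q hQ => (this Q (.inl hQ)).elim, fun Q hQ => (this Q (.inr hQ)).elim⟩
  obtain ⟨p, hp, hps⟩ := exists_isPosHomogeneousIn_forall_notMem (𝒜 := 𝒜) (P := P) (s.image core)
    (by
      simp only [Finset.mem_image, forall_exists_index, and_imp, forall_apply_eq_imp_iff₂]
      intro Q hQ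
      refine IsPrime.homogeneousCore ?_
      rcases (hs Q).1 hQ with h | h <;> exact IsAssociatedPrime.isPrime h)
    (by
      simp only [Finset.mem_image, forall_exists_index, and_imp, forall_apply_eq_imp_iff₂]
      exact fun Q _ => (Q.homogeneousCore 𝒜).isHomogeneous)
    (hne.image _)
    (by
      simp only [Finset.mem_image, forall_exists_index, and_imp, forall_apply_eq_imp_iff₂]
      intro Q hQ
      rcases (hs Q).1 hQ with h | h
      · exact ⟨a, ha, fun h' => hI Q h (toIdeal_homogeneousCore_le 𝒜 Q h')⟩
      · exact ⟨b, hb, fun h' => hJ Q h (toIdeal_homogeneousCore_le 𝒜 Q h')⟩)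
  have hp' : ∀ Q ∈ s, p ∉ Q := fun Q hQ => by
    rw [← hcore Q p (hp.2.imp fun _ => And.right)]
    exact hps _ (Finset.mem_image_of_mem _ hQ)
  exact ⟨p, hp, fun Q hQ => hp' Q ((hs Q).2 (.inl hQ)), fun Q hQ => hp' Q ((hs Q).2 (.inr hQ))⟩

variable (𝒜) in
/-- The annihilator `(I : P) / I` of `P` in `A ⧸ I` is generated by the class of a homogeneous
element of degree `e` whose annihilator is contained in `P`. -/
def HasSocleGenerator (P I : Ideal A) (e : ℕ) : Prop :=
  ∃ δ ∈ 𝒜 e, (∀ p ∈ P, p * δ ∈ I) ∧ (∀ s, (∀ p ∈ P, p * s ∈ I) → s ∈ I ⊔ span {δ}) ∧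
    ∀ q, q * δ ∈ I → q ∈ P

variable (𝒜) in
theorem hasSocleGenerator_self (P : Ideal A) : HasSocleGenerator 𝒜 P P 0 :=
  ⟨1, SetLike.one_mem_graded 𝒜, fun p hp => by simpa using hp, fun s _ => by simp,
    fun q hq => by simpa using hq⟩

/-- Replacing a regular element `u ∈ P` by another one `v ∈ P` changes the degree of the socle
generator by `deg v - deg u`. -/
theorem HasSocleGenerator.exchange {P L : Ideal A} (hP : P ≠ ⊤) (hL : L.IsHomogeneous 𝒜)
    {u v : A} {i j e : ℕ} (hu : u ∈ 𝒜 i) (hv : v ∈ 𝒜 j) (huP : u ∈ P) (hvP : v ∈ P)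
    (hur : L.IsRegularElemMod u) (hvr : L.IsRegularElemMod v)
    (h : HasSocleGenerator 𝒜 P (L ⊔ span {u}) e) :
    ∃ e', e' + i = e + j ∧ HasSocleGenerator 𝒜 P (L ⊔ span {v}) e' := by
  have mem_iff : ∀ {w x : A}, x ∈ L ⊔ span {w} ↔ ∃ t, x - w * t ∈ L := by
    intro w x
    constructor
    · intro hx
      obtain ⟨l, hl, _, ht, rfl⟩ := Submodule.mem_sup.1 hx
      obtain ⟨t, rfl⟩ := mem_span_singleton'.1 ht
      exact ⟨t, by convert hl using 1; ring⟩
    · rintro ⟨t, ht⟩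
      exact Submodule.mem_sup.2 ⟨_, ht, t * w, mem_span_singleton'.2 ⟨t, rfl⟩, by ring⟩
  obtain ⟨δ, hδ, hδ₁, hδ₂, hδ₃⟩ := h
  rcases hL.exists_of_mem_sup_span_singleton hu (SetLike.mul_mem_graded hv hδ)
    (hδ₁ v hvP) with h0 | ⟨e', δ', hδ', hdeg, hδδ'⟩
  · refine absurd ((eq_top_iff_one P).2 (hδ₃ 1 ?_)) hP
    rw [one_mul]
    exact Submodule.mem_sup_left (hvr _ h0)
  refine ⟨e', by rw [add_comm, hdeg, add_comm], δ', hδ', fun p hp => ?_, fun s hs => ?_,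
    fun q hq => ?_⟩
  · obtain ⟨t, ht⟩ := mem_iff.1 (hδ₁ p hp)
    refine mem_iff.2 ⟨t, hur _ ?_⟩
    have := L.sub_mem (L.mul_mem_left v ht) (L.mul_mem_left p hδδ')
    convert this using 1; ring
  · obtain ⟨t, ht⟩ := mem_iff.1 (hs u huP)
    have htP : ∀ p ∈ P, p * t ∈ L ⊔ span {u} := by
      intro p hp
      obtain ⟨r, hr⟩ := mem_iff.1 (hs p hp)
      refine mem_iff.2 ⟨r, hvr _ ?_⟩
      have := L.sub_mem (L.mul_mem_left u hr) (L.mul_mem_left p ht)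
      convert this using 1; ring
    obtain ⟨l, hl, _, hq, hlq⟩ := Submodule.mem_sup.1 (hδ₂ t htP)
    obtain ⟨q, rfl⟩ := mem_span_singleton'.1 hq
    obtain ⟨r, hr⟩ := mem_iff.1 hl
    have hmem : s - v * r - q * δ' ∈ L := hur _ (by
      have := L.add_mem (L.add_mem ht (L.mul_mem_left v hr)) (L.mul_mem_left q hδδ')
      convert this using 1
      linear_combination (-v) * hlq)
    refine Submodule.mem_sup.2 ⟨s - q * δ', mem_iff.2 ⟨r, by convert hmem using 1; ring⟩,
      q * δ', mem_span_singleton'.2 ⟨q, rfl⟩, by ring⟩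
  · obtain ⟨r, hr⟩ := mem_iff.1 hq
    refine hδ₃ q (mem_iff.2 ⟨r, hvr _ ?_⟩)
    have := L.add_mem (L.mul_mem_left u hr) (L.mul_mem_left q hδδ')
    convert this using 1; ring

/-- Passing from one regular sequence of forms of degree `i` in `P` to another one of the same
length, of forms of degree `j`, shifts the degree of the socle generator by the total degree. -/
theorem HasSocleGenerator.of_isRegularSeqMod [IsNoetherianRing A] {P I : Ideal A} (hP : P ≠ ⊤)
    (hI : I.IsHomogeneous 𝒜) {i j : ℕ} (hi : 0 < i) (hj : 0 < j) {l m : List A}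
    (hlen : l.length = m.length)
    (hl : ∀ x ∈ l, x ∈ P ∧ x ∈ 𝒜 i) (hm : ∀ x ∈ m, x ∈ P ∧ x ∈ 𝒜 j)
    (hlr : I.IsRegularSeqMod l) (hmr : I.IsRegularSeqMod m) {e : ℕ}
    (h : HasSocleGenerator 𝒜 P (I ⊔ ofList l) e) :
    ∃ e', e' + l.length * i = e + l.length * j ∧ HasSocleGenerator 𝒜 P (I ⊔ ofList m) e' := by
  induction l generalizing I m e with
  | nil =>
    obtain rfl : m = [] := List.length_eq_zero_iff.1 hlen.symm
    exact ⟨e, by simp, h⟩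
  | cons u l ih =>
    obtain _ | ⟨v, m⟩ := m
    · simp at hlen
    have hl' : ∀ x ∈ l, ∃ i, 0 < i ∧ x ∈ 𝒜 i := fun x hx => ⟨i, hi, (hl x (by simp [hx])).2⟩
    have hm' : ∀ x ∈ m, ∃ i, 0 < i ∧ x ∈ 𝒜 i := fun x hx => ⟨j, hj, (hm x (by simp [hx])).2⟩
    obtain ⟨huP, hu⟩ := hl u (by simp)
    obtain ⟨hvP, hv⟩ := hm v (by simp)
    obtain ⟨hlr', hur⟩ := hI.isRegularSeqMod_tail
      (fun x hx => ⟨i, hi, (hl x hx).2⟩) hlr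
    obtain ⟨hmr', hvr⟩ := hI.isRegularSeqMod_tail
      (fun x hx => ⟨j, hj, (hm x hx).2⟩) hmr
    obtain ⟨p, ⟨hpP, r, hr, hp⟩, hpl, hpm⟩ := exists_isPosHomogeneousIn_isRegularElemMod
      (𝒜 := 𝒜) (P := P) ⟨huP, i, hi, hu⟩ ⟨hvP, j, hj, hv⟩ hur hvr
    have hl'' := hI.isRegularSeqMod_cons hl' hlr' hpl
    have hm'' := hI.isRegularSeqMod_cons hm' hmr' hpm
    have hswap : ∀ (x : A) (l : List A), I ⊔ ofList (x :: l) = I ⊔ ofList l ⊔ span {x} := by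
      intro x l
      rw [ofList_cons, sup_comm (span {x}), sup_assoc]
    rw [hswap] at h
    obtain ⟨e₁, he₁, h₁⟩ := h.exchange hP
      (hI.sup_ofList fun x hx => (hl' x hx).imp fun _ => And.right) hu hp huP hpP hur hpl
    rw [sup_right_comm] at h₁
    obtain ⟨e₂, he₂, h₂⟩ := ih (hI.sup_span_singleton hp) (by simpa using hlen)
      (fun x hx => hl x (by simp [hx])) (fun x hx => hm x (by simp [hx])) hl''.2 hm''.2 h₁
    rw [sup_right_comm] at h₂
    obtain ⟨e₃, he₃, h₃⟩ := h₂.exchange hP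
      (hI.sup_ofList fun x hx => (hm' x hx).imp fun _ => And.right) hp hv hpP hvP hpm hvr
    refine ⟨e₃, ?_, by rwa [hswap]⟩
    simp only [List.length_cons, add_mul, one_mul]
    omega

theorem IsHomogeneous.mem_of_mem_sup_ofList_of_lt {I : Ideal A} (hI : I.IsHomogeneous 𝒜)
    {d e : ℕ} (hed : e < d) {l : List A} (hl : ∀ a ∈ l, a ∈ 𝒜 d) {x : A} (hx : x ∈ 𝒜 e)
    (h : x ∈ I ⊔ ofList l) : x ∈ I := by
  induction l with
  | nil => simpa using h
  | cons a l ih =>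
    rw [ofList_cons, sup_comm (span {a}), ← sup_assoc] at h
    have hl' : ∀ a ∈ l, a ∈ 𝒜 d := fun a ha => hl a (by simp [ha])
    rcases (hI.sup_ofList fun a ha => ⟨d, hl' a ha⟩).exists_of_mem_sup_span_singleton
      (hl a (by simp)) hx h with h | ⟨j, _, _, hj, _⟩
    · exact ih hl' h
    · omega

theorem IsHomogeneous.isRegularSeqMod_drop {I : Ideal A} (hI : I.IsHomogeneous 𝒜)
    {l : List A} (hl : ∀ x ∈ l, ∃ i, 0 < i ∧ x ∈ 𝒜 i) (h : I.IsRegularSeqMod l) (b : ℕ) :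
    I.IsRegularSeqMod (l.drop b) := by
  induction b generalizing l with
  | zero => simpa using h
  | succ b ih =>
    cases l with
    | nil => simpa using h
    | cons a l =>
      exact ih (fun x hx => hl x (by simp [hx])) (hI.isRegularSeqMod_tail hl h).1

end Graded

end Ideal

namespace MvPolynomial

open Ideal

attribute [local instance] MvPolynomial.gradedAlgebra

variable {σ k : Type*} [Field k] {s : Set σ}

theorem isRegularSeqMod_span_X (l : List σ) (hl : l.Nodup) (hs : ∀ i ∈ l, i ∉ s) :
    (span (X '' s : Set (MvPolynomial σ k))).IsRegularSeqMod (l.map X) := by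
  induction l generalizing s with
  | nil => trivial
  | cons a l ih =>
    rw [List.nodup_cons] at hl
    refine ⟨fun x hx => ?_, ?_⟩
    · rw [mem_ideal_span_X_image] at hx ⊢
      intro m hm
      obtain ⟨i, hi, hmi⟩ := hx (Finsupp.single a 1 + m) (by
        rw [mem_support_iff] at hm ⊢
        rwa [coeff_X_mul])
      have hia : a ≠ i := by
        rintro rfl
        exact hs a (by simp) hi
      exact ⟨i, hi, by simpa [Finsupp.single_eq_of_ne' hia] using hmi⟩
    · have := ih (s := insert a s) hl.2 (fun i hi => by
        rintro (rfl | h)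
        · exact hl.1 hi
        · exact hs i (by simp [hi]) h)
      rwa [Set.image_insert_eq, span_insert, sup_comm] at this

theorem monomial_mem_span_X_pow {m : σ →₀ ℕ} (hm : ↑m.support ⊆ s) (c : k) :
    monomial m c ∈ span (X '' s : Set (MvPolynomial σ k)) ^ m.degree := by
  rw [monomial_eq, Finsupp.degree_apply, ← Finset.prod_pow_eq_pow_sum, Finsupp.prod]
  exact Ideal.mul_mem_left _ _ (Ideal.prod_mem_prod fun i hi =>
    Ideal.pow_mem_pow (subset_span (Set.mem_image_of_mem _ (hm hi))) _)

theorem monomial_mem_supported {m : σ →₀ ℕ} (hm : ↑m.support ⊆ s) (c : k) :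
    monomial m c ∈ supported k s := by
  rw [monomial_eq]
  exact mul_mem (Subalgebra.algebraMap_mem _ c) (prod_mem fun i hi =>
    pow_mem (X_mem_supported.2 (hm hi)) _)

theorem isHomogeneous_span_X : (span (X '' s : Set (MvPolynomial σ k))).IsHomogeneous
    (homogeneousSubmodule σ k) :=
  homogeneous_span _ _ (by rintro _ ⟨i, -, rfl⟩; exact ⟨1, isHomogeneous_X k i⟩)

/-- A form of degree `e` that is annihilated modulo `J` by all products of `t` forms in
`(X i | i ∈ s)`, with `e + t` at most the socle degree, lies in `J`. -/
theorem mem_of_forall_pow_mul_mem {J : Ideal (MvPolynomial σ k)}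
    (hJ : J.IsHomogeneous (homogeneousSubmodule σ k)) {N : ℕ}
    (h : HasSocleGenerator (homogeneousSubmodule σ k) (span (X '' s)) J N)
    {e t : ℕ} (het : e + t ≤ N) {u : MvPolynomial σ k} (hu : u.IsHomogeneous e)
    (hw : ∀ w ∈ span (X '' s) ^ t, w.IsHomogeneous t → w * u ∈ J) : u ∈ J := by
  induction t with
  | zero => simpa using hw 1 (by simp) (isHomogeneous_one σ k)
  | succ t ih =>
    refine ih (by omega) fun w hwP hwt => ?_
    obtain ⟨δ, hδ, -, hδ₂, -⟩ := h
    have hmem : w * u ∈ J ⊔ span {δ} := hδ₂ _ fun p hp => by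
      induction hp using Submodule.span_induction with
      | mem x hx =>
        rw [← mul_assoc]
        refine hw _ ?_ ?_
        · rw [pow_succ']
          exact Ideal.mul_mem_mul (subset_span hx) hwP
        · obtain ⟨i, -, rfl⟩ := hx
          rw [add_comm]
          exact (isHomogeneous_X k i).mul hwt
      | zero => simp
      | add x y _ _ hx hy => rw [add_mul]; exact J.add_mem hx hy
      | smul a x _ hx => rw [smul_mul_assoc]; exact J.mul_mem_left a hx
    rcases hJ.exists_of_mem_sup_span_singleton hδ (hwt.mul hu) hmem with h | ⟨j, _, _, hj, _⟩
    · exact h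
    · omega

/-- Distinct monomials in the variables outside `s` are independent over the socle. -/
theorem mem_of_sum_monomial_mul_mem {J : Ideal (MvPolynomial σ k)}
    (hJ : J.IsHomogeneous (homogeneousSubmodule σ k)) {N : ℕ}
    (h : HasSocleGenerator (homogeneousSubmodule σ k) (span (X '' s)) J N)
    {B : Finset (σ →₀ ℕ)} (hB : ∀ β ∈ B, ∀ i ∈ s, β i = 0)
    {F : (σ →₀ ℕ) → MvPolynomial σ k} (hF : ∀ β ∈ B, (F β).IsHomogeneous N)
    (hFs : ∀ β ∈ B, ∀ p ∈ span (X '' s), p * F β ∈ J)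
    (hsum : ∑ β ∈ B, monomial β 1 * F β ∈ J) : ∀ β ∈ B, F β ∈ J := by
  classical
  obtain ⟨δ, hδ, -, hδ₂, hδ₃⟩ := h
  have hc : ∀ β ∈ B, ∃ c : k, F β - C c * δ ∈ J := by
    intro β hβ
    rcases hJ.exists_of_mem_sup_span_singleton hδ (hF β hβ) (hδ₂ _ (hFs β hβ)) with
      h | ⟨j, t, ht, hj, htJ⟩
    · exact ⟨0, by simpa using h⟩
    · obtain rfl : j = 0 := by omega
      rw [mem_homogeneousSubmodule, ← totalDegree_zero_iff_isHomogeneous,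
        totalDegree_eq_zero_iff_eq_C] at ht
      exact ⟨coeff 0 t, by rw [← ht, mul_comm]; exact htJ⟩
  choose! c hc using hc
  have hmem : (∑ β ∈ B, monomial β (c β)) * δ ∈ J := by
    have h₁ : ∑ β ∈ B, monomial β 1 * (F β - C (c β) * δ) ∈ J :=
      J.sum_mem fun β hβ => J.mul_mem_left _ (hc β hβ)
    convert J.sub_mem hsum h₁ using 1
    rw [← Finset.sum_sub_distrib, Finset.sum_mul]
    refine Finset.sum_congr rfl fun β _ => ?_
    have : (monomial β (c β) : MvPolynomial σ k) = monomial β 1 * C (c β) := by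
      rw [mul_comm, C_mul_monomial, mul_one]
    rw [this]
    ring
  have hP := mem_ideal_span_X_image.1 (hδ₃ _ hmem)
  intro β hβ
  have hcβ : c β = 0 := by
    by_contra hne
    obtain ⟨i, hi, hβi⟩ := hP β (by
      rw [mem_support_iff, coeff_sum]
      simpa [coeff_monomial, hβ] using hne)
    exact hβi (hB β hβ i hi)
  simpa [hcβ] using hc β hβ

/-- A polynomial is a sum of monomials in the variables outside `s` times polynomials in the
variables in `s`. -/
theorem exists_eq_sum_monomial_mul {f : MvPolynomial σ k} {d : ℕ} (hf : f.IsHomogeneous d) :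
    ∃ (B : Finset (σ →₀ ℕ)) (F : (σ →₀ ℕ) → MvPolynomial σ k),
      f = ∑ β ∈ B, monomial β 1 * F β ∧ ∀ β ∈ B, (∀ i ∈ s, β i = 0) ∧ β.degree ≤ d ∧
        (F β).IsHomogeneous (d - β.degree) ∧ F β ∈ supported k s ∧
        F β ∈ span (X '' s : Set (MvPolynomial σ k)) ^ (d - β.degree) := by
  classical
  let z : (σ →₀ ℕ) → (σ →₀ ℕ) := fun m => m.filter (· ∉ s)
  let y : (σ →₀ ℕ) → (σ →₀ ℕ) := fun m => m.filter (· ∈ s)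
  have hzy : ∀ m, z m + y m = m := fun m => by
    rw [add_comm]; exact Finsupp.filter_add_filter_not m _
  have hdeg : ∀ m ∈ f.support, (z m).degree + (y m).degree = d := fun m hm => by
    rw [← map_add, hzy, Finsupp.degree_apply]
    exact (hf.degree_eq_sum_deg_support hm).symm
  have hy : ∀ m, ↑(y m).support ⊆ s := fun m i hi => by
    by_contra his
    exact (Finsupp.mem_support_iff.1 hi) (Finsupp.filter_apply_neg _ _ his)
  refine ⟨f.support.image z,
    fun β => ∑ m ∈ f.support with z m = β, monomial (y m) (coeff m f), ?_, ?_⟩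
  · conv_lhs => rw [f.as_sum]
    rw [← Finset.sum_fiberwise_of_maps_to (g := z)
      (fun m hm => Finset.mem_image_of_mem z hm)]
    refine Finset.sum_congr rfl fun β _ => ?_
    rw [Finset.mul_sum]
    refine Finset.sum_congr rfl fun m hm => ?_
    rw [monomial_mul, one_mul, ← (Finset.mem_filter.1 hm).2, hzy]
  · intro β hβ
    obtain ⟨m₀, hm₀, rfl⟩ := Finset.mem_image.1 hβ
    have hm : ∀ m ∈ f.support.filter (z · = z m₀), (y m).degree = d - (z m₀).degree := by
      intro m hm
      obtain ⟨hm, hmz⟩ := Finset.mem_filter.1 hm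
      have := hdeg m hm
      rw [hmz] at this
      omega
    refine ⟨fun i hi => Finsupp.filter_apply_neg _ _ (by simpa using hi), ?_, ?_, ?_, ?_⟩
    · have := hdeg m₀ hm₀
      omega
    · exact IsHomogeneous.sum _ _ _ fun m h => isHomogeneous_monomial _ (hm m h)
    · exact sum_mem fun m _ => monomial_mem_supported (hy m) _
    · refine sum_mem fun m h => ?_
      rw [← hm m h]
      exact monomial_mem_span_X_pow (hy m) _

theorem mem_supported_of_hasSocleGenerator {J : Ideal (MvPolynomial σ k)}
    (hJ : J.IsHomogeneous (homogeneousSubmodule σ k)) {N d : ℕ} (hdN : d ≤ N + 1)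
    (h : HasSocleGenerator (homogeneousSubmodule σ k) (span (X '' s)) J N)
    (hpow : span (X '' s) ^ (N + 1) ≤ J)
    (hlow : ∀ e < d, ∀ u ∈ J, u.IsHomogeneous e → u = 0)
    {f : MvPolynomial σ k} (hfJ : f ∈ J) (hf : f.IsHomogeneous d) :
    f ∈ supported k s := by
  classical
  obtain ⟨B, F, hfB, hBF⟩ := exists_eq_sum_monomial_mul (s := s) hf
  suffices hzero : ∀ β ∈ B, β ≠ 0 → F β = 0 by
    rw [hfB]
    refine sum_mem fun β hβ => ?_
    by_cases h0 : β = 0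
    · subst h0
      simpa using (hBF 0 hβ).2.2.2.1
    · simp [hzero β hβ h0]
  by_contra! hex
  obtain ⟨β', hβ'B, hβ'0, hβ'F⟩ := hex
  obtain ⟨β₀, hβ₀, hmax⟩ := (B.filter fun β => β ≠ 0 ∧ F β ≠ 0).exists_max_image Finsupp.degree
    ⟨β', Finset.mem_filter.2 ⟨hβ'B, hβ'0, hβ'F⟩⟩
  obtain ⟨hβ₀B, hβ₀0, hβ₀F⟩ := Finset.mem_filter.1 hβ₀
  have hM : β₀.degree ≠ 0 := by rwa [Ne, Finsupp.degree_eq_zero_iff]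
  set M := β₀.degree
  have hMd : M ≤ d := (hBF β₀ hβ₀B).2.1
  have hmemJ : F β₀ ∈ J := by
    refine mem_of_forall_pow_mul_mem hJ h (e := d - M) (t := N - (d - M)) (by omega)
      (hBF β₀ hβ₀B).2.2.1 fun w hw hwt => ?_
    have hhigh : ∀ β ∈ B, β.degree < M → monomial β 1 * (w * F β) ∈ J := fun β hβ hlt => by
      have hFβ := (hBF β hβ).2.2.2.2
      have hmul := Ideal.mul_mem_mul hw hFβ
      rw [← pow_add] at hmul
      exact J.mul_mem_left _ (hpow (Ideal.pow_le_pow_right (by omega) hmul))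
    have hrest : ∑ β ∈ B with ¬ β.degree = M, monomial β 1 * (w * F β) ∈ J := by
      refine J.sum_mem fun β hβ => ?_
      obtain ⟨hβ, hne⟩ := Finset.mem_filter.1 hβ
      rcases lt_or_gt_of_ne hne with hlt | hgt
      · exact hhigh β hβ hlt
      · have : F β = 0 := by
          by_contra hF0
          have := hmax β (Finset.mem_filter.2 ⟨hβ, by rintro rfl; simp at hgt, hF0⟩)
          omega
        simp [this]
    have htop : ∑ β ∈ B with β.degree = M, monomial β 1 * (w * F β) ∈ J := by
      rw [← J.add_mem_iff_left hrest, Finset.sum_filter_add_sum_filter_not]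
      convert J.mul_mem_left w hfJ using 1
      rw [hfB, Finset.mul_sum]
      exact Finset.sum_congr rfl fun β _ => by ring
    refine mem_of_sum_monomial_mul_mem hJ h (F := fun β => w * F β)
      (fun β hβ => (hBF β (Finset.mem_filter.1 hβ).1).1) (fun β hβ => ?_) (fun β hβ p hp => ?_)
      htop β₀ (Finset.mem_filter.2 ⟨hβ₀B, rfl⟩)
    · obtain ⟨hβ, hβM⟩ := Finset.mem_filter.1 hβ
      have := hwt.mul (hBF β hβ).2.2.1
      rwa [hβM, Nat.sub_add_cancel (by omega)] at this
    · obtain ⟨hβ, hβM⟩ := Finset.mem_filter.1 hβ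
      have hmul := Ideal.mul_mem_mul hp (Ideal.mul_mem_mul hw (hBF β hβ).2.2.2.2)
      rw [← pow_add, ← pow_succ', hβM, Nat.sub_add_cancel (by omega)] at hmul
      exact hpow hmul
  exact hβ₀F (hlow (d - M) (by omega) _ hmemJ (hBF β₀ hβ₀B).2.2.1)

end MvPolynomial

/-- Lemma 3.5: if `g_1,…,g_n` is a regular sequence of degree-`d` forms with
`(g_{b+1},…,g_n) ⊆ (x_{b+1},…,x_n)` and `(x_{b+1},…,x_n)^{(n-b)(d-1)+1} ⊆ (g_{b+1},…,g_n)`,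
then each of `g_{b+1},…,g_n` is a polynomial in `x_{b+1},…,x_n` alone. -/
theorem stmt8 {k : Type*} [Field k] {n d b : ℕ} (hb1 : 1 ≤ b) (hb2 : b ≤ n - 1)
    (g : Fin n → MvPolynomial (Fin n) k)
    (hhom : ∀ i, (g i).IsHomogeneous d)
    (hreg : RingTheory.Sequence.IsRegular (MvPolynomial (Fin n) k) (List.ofFn g))
    (hmem : Ideal.span {p : MvPolynomial (Fin n) k | ∃ i : Fin n, b ≤ (i : ℕ) ∧ p = g i} ≤
      Ideal.span {p : MvPolynomial (Fin n) k | ∃ j : Fin n, b ≤ (j : ℕ) ∧ p = X j})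
    (hpow : (Ideal.span {p : MvPolynomial (Fin n) k | ∃ j : Fin n, b ≤ (j : ℕ) ∧ p = X j}) ^
        ((n - b) * (d - 1) + 1) ≤
      Ideal.span {p : MvPolynomial (Fin n) k | ∃ i : Fin n, b ≤ (i : ℕ) ∧ p = g i}) :
    ∀ i : Fin n, b ≤ (i : ℕ) →
      g i ∈ MvPolynomial.supported k {j : Fin n | b ≤ (j : ℕ)} := by
  classical
  let _ := MvPolynomial.gradedAlgebra (σ := Fin n) (R := k)
  rcases Nat.eq_zero_or_pos d with rfl | hd
  · intro i _
    rw [totalDegree_eq_zero_iff_eq_C.1 ((totalDegree_zero_iff_isHomogeneous _).2 (hhom i))]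
    exact Subalgebra.algebraMap_mem _ _
  set s : Set (Fin n) := {j : Fin n | b ≤ (j : ℕ)} with hs
  have hmemL : ∀ i : Fin n, i ∈ (List.finRange n).drop b ↔ b ≤ (i : ℕ) := by
    intro i
    rw [List.mem_drop_iff_getElem]
    constructor
    · rintro ⟨j, hj, rfl⟩
      simp
    · intro hi
      exact ⟨i - b, by simp; omega, by ext; simp; omega⟩
  have hofList : ∀ a : Fin n → MvPolynomial (Fin n) k,
      Ideal.ofList (((List.finRange n).drop b).map a) =
        Ideal.span {p | ∃ i : Fin n, b ≤ (i : ℕ) ∧ p = a i} := by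
    intro a
    refine congrArg Ideal.span (Set.ext fun p => ?_)
    simp only [Set.mem_ofPred_eq, List.mem_map, hmemL, eq_comm (b := p)]
  have hX : {p : MvPolynomial (Fin n) k | ∃ j : Fin n, b ≤ (j : ℕ) ∧ p = X j} = X '' s := by
    ext p
    simp [hs, eq_comm (b := p)]
  rw [← hofList g, hX] at hmem hpow
  have hbot : (⊥ : Ideal (MvPolynomial (Fin n) k)).IsHomogeneous
      (homogeneousSubmodule (Fin n) k) := Ideal.IsHomogeneous.bot _
  have hgreg : (⊥ : Ideal (MvPolynomial (Fin n) k)).IsRegularSeqMod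
      (((List.finRange n).drop b).map g) := by
    rw [List.map_drop, ← List.ofFn_eq_map]
    refine hbot.isRegularSeqMod_drop (fun x hx => ?_)
      (Ideal.isRegularSeqMod_bot_of_isWeaklyRegular hreg.toIsWeaklyRegular) b
    obtain ⟨i, rfl⟩ := (List.mem_ofFn' _ _).1 hx
    exact ⟨d, hd, hhom i⟩
  have hXreg : (⊥ : Ideal (MvPolynomial (Fin n) k)).IsRegularSeqMod
      (((List.finRange n).drop b).map X) := by
    have := isRegularSeqMod_span_X (k := k) (s := ∅) ((List.finRange n).drop b)
      ((List.nodup_finRange n).sublist (List.drop_sublist _ _)) (by simp)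
    simpa using this
  have hP : Ideal.span (X '' s : Set (MvPolynomial (Fin n) k)) ≠ ⊤ := by
    rw [Ne, Ideal.eq_top_iff_one, mem_ideal_span_X_image]
    intro h
    obtain ⟨i, -, hi⟩ := h 0 (by simp)
    simp at hi
  have hgP : ∀ x ∈ ((List.finRange n).drop b).map g,
      x ∈ Ideal.span (X '' s) ∧ x ∈ homogeneousSubmodule (Fin n) k d := by
    intro x hx
    refine ⟨hmem (Ideal.subset_span hx), ?_⟩
    obtain ⟨i, -, rfl⟩ := List.mem_map.1 hx
    exact hhom i
  have hXP : ∀ x ∈ ((List.finRange n).drop b).map (X : Fin n → MvPolynomial (Fin n) k),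
      x ∈ Ideal.span (X '' s) ∧ x ∈ homogeneousSubmodule (Fin n) k 1 := by
    intro x hx
    obtain ⟨i, hi, rfl⟩ := List.mem_map.1 hx
    exact ⟨Ideal.subset_span (Set.mem_image_of_mem X ((hmemL i).1 hi)), isHomogeneous_X k i⟩
  obtain ⟨N, hN, hsoc⟩ := Ideal.HasSocleGenerator.of_isRegularSeqMod hP hbot one_pos hd
    (by simp) hXP hgP hXreg hgreg
    (e := 0) (by rw [hofList X, hX, bot_sup_eq]; exact Ideal.hasSocleGenerator_self _ _)
  rw [bot_sup_eq] at hsoc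
  have hNeq : N = (n - b) * (d - 1) := by
    simp only [List.length_map, List.length_drop, List.length_finRange] at hN
    rw [Nat.mul_sub]
    omega
  rw [← hNeq] at hpow
  have hdN : d ≤ N + 1 := by
    rcases Nat.eq_zero_or_pos n with rfl | hn
    · omega
    have := Nat.le_mul_of_pos_left (d - 1) (show 0 < n - b by omega)
    omega
  have hlow : ∀ e < d, ∀ u ∈ Ideal.ofList (((List.finRange n).drop b).map g),
      u.IsHomogeneous e → u = 0 := fun e he u hu hue =>
    hbot.mem_of_mem_sup_ofList_of_lt he (fun a ha => (hgP a ha).2) hue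
      (by rwa [bot_sup_eq])
  have hJ : (Ideal.ofList (((List.finRange n).drop b).map g)).IsHomogeneous
      (homogeneousSubmodule (Fin n) k) :=
    Ideal.homogeneous_span _ _ fun x hx => ⟨d, (hgP x hx).2⟩
  intro i hi
  exact mem_supported_of_hasSocleGenerator hJ hdN hsoc hpow hlow
    (Ideal.subset_span (List.mem_map_of_mem ((hmemL i).2 hi))) (hhom i)
end
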